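/- Consider the Bayesian GLM posterior with location-family prior: π_loc ∝ exp(−V_loc) on ℝ^{1+d}, V_loc(ϑ, β) = g(ϑ) − wᵀβ + ∑_{i=1}^n ψ(X_iᵀβ)/c(σ) + ∑_{j=1}^d ϱ(β_j − ϑ), where X₁, …, X_n ∈ ℝ^d, w ∈ ℝ^d, c(σ) > 0, and g, ψ, ϱ : ℝ → ℝ are C². Assume b ≤ ψ'' ≤ B with B ≥ b > 0, 0 ≤ ϱ'' ≤ R, A := (1/c(σ)) ∑_{i=1}^n X_i X_iᵀ ⪰ a I for some a > 0, and α ≤ g'' ≤ L with ℓ′_V := α − dR²/(ab) > 0. Then the star-structured variational minimizer π⋆_loc (with ϑ as root variable) satisfies KL(π⋆_loc ‖ π_loc) ≤ ((dR + L)/(a² b² ℓ′_V)) · ‖ ∑_{i=1}^d ∑_{j>i} 𝒜_{ij}(β)² ‖_{L∞}, where 𝒜(β) := (1/c(σ)) XᵀD(β)X with X the n×d matrix whose rows are the X_iᵀ and D(β) the diagonal matrix with D_{ii}(β) = ψ''(X_iᵀβ). -/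

import Mathlib

open MeasureTheory ProbabilityTheory
open scoped ENNReal ProbabilityTheory

open Classical in
/-- Kullback–Leibler divergence: `∫ log (dμ/dπ) dμ` if `μ ≪ π` (and the integral is
well-defined), and `+∞` otherwise. -/
noncomputable def KL {E : Type*} [MeasurableSpace E] (μ π : Measure E) : ℝ≥0∞ :=
  if μ ≪ π ∧ Integrable (fun z => Real.log (μ.rnDeriv π z).toReal) μ then
    ENNReal.ofReal (∫ z, Real.log (μ.rnDeriv π z).toReal ∂μ)
  else ⊤

/-- The star-structured measure on `ℝ × ℝ^k` with root marginal `μ₁` and leaf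
conditional kernels `κ j`, i.e. `μ₁(dz₁) ∏_j κ_j(dz_j ∣ z₁)`. -/
noncomputable def starMeasure {k : ℕ} (μ₁ : Measure ℝ) (κ : Fin k → Kernel ℝ ℝ) :
    Measure (ℝ × (Fin k → ℝ)) :=
  μ₁.bind fun z₁ => (Measure.dirac z₁).prod (Measure.pi fun j => κ j z₁)

/-- `μ ∈ C_star`: the leaf coordinates are conditionally independent given the root. -/
def IsStar {k : ℕ} (μ : Measure (ℝ × (Fin k → ℝ))) : Prop :=
  IsProbabilityMeasure μ ∧
    ∃ (μ₁ : Measure ℝ) (κ : Fin k → Kernel ℝ ℝ),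
      IsProbabilityMeasure μ₁ ∧ (∀ j, IsMarkovKernel (κ j)) ∧ μ = starMeasure μ₁ κ

/-- The probability measure with density proportional to `exp (-V)` (w.r.t. Lebesgue). -/
noncomputable def gibbs {E : Type*} [MeasureSpace E] (V : E → ℝ) : Measure E :=
  ((volume.withDensity fun z => ENNReal.ofReal (Real.exp (-V z))) Set.univ)⁻¹ •
    (volume.withDensity fun z => ENNReal.ofReal (Real.exp (-V z)))

section

open Filter Topology Set

theorem quadratic_lower_bound {f f' : ℝ → ℝ} {c : ℝ} (hf : ∀ x, HasDerivAt f (f' x) x)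
    (hc : ∀ x y, x ≤ y → c * (y - x) ≤ f' y - f' x) (x y : ℝ) :
    f x + f' x * (y - x) + c / 2 * (y - x) ^ 2 ≤ f y := by
  have hd : ∀ t, HasDerivAt (fun t => f t - f' x * (t - x) - c / 2 * (t - x) ^ 2)
      (f' t - f' x - c * (t - x)) t := by
    intro t
    have h1 : HasDerivAt (fun t : ℝ => t - x) 1 t := (hasDerivAt_id t).sub_const x
    have h := ((hf t).sub (h1.const_mul (f' x))).sub ((h1.pow 2).const_mul (c / 2))
    exact h.congr_deriv (by norm_num; ring)
  have hcont : Continuous (fun t => f t - f' x * (t - x) - c / 2 * (t - x) ^ 2) :=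
    continuous_iff_continuousAt.2 fun t => (hd t).continuousAt
  rcases le_total x y with h | h
  · have hm : MonotoneOn (fun t => f t - f' x * (t - x) - c / 2 * (t - x) ^ 2) (Set.Ici x) := by
      apply monotoneOn_of_deriv_nonneg (convex_Ici x) hcont.continuousOn
        (fun t _ => (hd t).differentiableAt.differentiableWithinAt)
      intro t ht
      rw [interior_Ici] at ht
      rw [(hd t).deriv]
      linarith [hc x t (le_of_lt ht)]
    have := hm (Set.self_mem_Ici) (Set.mem_Ici.2 h) h
    simp at this
    linarith
  · have hm : AntitoneOn (fun t => f t - f' x * (t - x) - c / 2 * (t - x) ^ 2) (Set.Iic x) := by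
      apply antitoneOn_of_deriv_nonpos (convex_Iic x) hcont.continuousOn
        (fun t _ => (hd t).differentiableAt.differentiableWithinAt)
      intro t ht
      rw [interior_Iic] at ht
      rw [(hd t).deriv]
      linarith [hc t x (le_of_lt ht)]
    have := hm (Set.mem_Iic.2 h) (Set.self_mem_Iic) h
    simp at this
    linarith

theorem quadratic_upper_bound {f f' : ℝ → ℝ} {c : ℝ} (hf : ∀ x, HasDerivAt f (f' x) x)
    (hc : ∀ x y, x ≤ y → f' y - f' x ≤ c * (y - x)) (x y : ℝ) :
    f y ≤ f x + f' x * (y - x) + c / 2 * (y - x) ^ 2 := by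
  have := quadratic_lower_bound (f := fun t => -f t) (f' := fun t => -f' t) (c := -c)
    (fun t => (hf t).neg) (fun x y h => by linarith [hc x y h]) x y
  linarith

/-- `u` is a normalized potential on the line whose derivative `v` has slopes in `[κ, K]`. -/
structure IsNicePotential (κ K : ℝ) (u v : ℝ → ℝ) : Prop where
  hasDerivAt : ∀ x, HasDerivAt u (v x) x
  lower : ∀ x y, x ≤ y → κ * (y - x) ≤ v y - v x
  upper : ∀ x y, x ≤ y → v y - v x ≤ K * (y - x)
  integral_exp : ∫ x, Real.exp (-u x) = 1

/-- The measure on the line with density `exp (-u)`. -/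
noncomputable def densityMeasure (u : ℝ → ℝ) : Measure ℝ :=
  volume.withDensity fun x => ENNReal.ofReal (Real.exp (-u x))

namespace IsNicePotential

variable {κ K : ℝ} {u v : ℝ → ℝ}

theorem abs_sub_le (h : IsNicePotential κ K u v) (hκ : 0 ≤ κ) (x y : ℝ) :
    |v x - v y| ≤ K * |x - y| := by
  rcases le_total x y with hxy | hxy
  · rw [abs_sub_comm, abs_sub_comm x, abs_of_nonneg (sub_nonneg.2 hxy), abs_of_nonneg]
    · exact h.upper x y hxy
    · exact (mul_nonneg hκ (sub_nonneg.2 hxy)).trans (h.lower x y hxy)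
  · rw [abs_of_nonneg (sub_nonneg.2 hxy), abs_of_nonneg]
    · exact h.upper y x hxy
    · exact (mul_nonneg hκ (sub_nonneg.2 hxy)).trans (h.lower y x hxy)

theorem K_nonneg (h : IsNicePotential κ K u v) (hκ : 0 ≤ κ) : 0 ≤ K := by
  have := h.abs_sub_le hκ 1 0
  simp at this
  exact (abs_nonneg _).trans this

theorem continuous (h : IsNicePotential κ K u v) : Continuous u :=
  continuous_iff_continuousAt.2 fun t => (h.hasDerivAt t).continuousAt

theorem continuous_deriv (h : IsNicePotential κ K u v) (hκ : 0 ≤ κ) : Continuous v := by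
  have : LipschitzWith ⟨K, h.K_nonneg hκ⟩ v := by
    apply LipschitzWith.of_dist_le_mul
    intro x y
    rw [Real.dist_eq, Real.dist_eq]
    exact h.abs_sub_le hκ x y
  exact this.continuous

theorem lower_bound (h : IsNicePotential κ K u v) (x y : ℝ) :
    u x + v x * (y - x) + κ / 2 * (y - x) ^ 2 ≤ u y :=
  quadratic_lower_bound h.hasDerivAt h.lower x y

theorem upper_bound (h : IsNicePotential κ K u v) (x y : ℝ) :
    u y ≤ u x + v x * (y - x) + K / 2 * (y - x) ^ 2 :=
  quadratic_upper_bound h.hasDerivAt h.upper x y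

theorem abs_le_quadratic (h : IsNicePotential κ K u v) (hκ : 0 ≤ κ) :
    ∃ C, 0 ≤ C ∧ ∀ x, |u x| ≤ C * (1 + x ^ 2) := by
  have hK := h.K_nonneg hκ
  refine ⟨|u 0| + |v 0| + K, by positivity, fun x => ?_⟩
  have h1 := h.lower_bound 0 x
  have h2 := h.upper_bound 0 x
  have h3 : |v 0 * x| ≤ |v 0| * (1 + x ^ 2) := by
    rw [abs_mul]
    gcongr
    exact abs_le.2 ⟨by nlinarith [sq_nonneg (x + 1)], by nlinarith [sq_nonneg (x - 1)]⟩
  have h4 := neg_abs_le (v 0 * x)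
  have h5 := le_abs_self (v 0 * x)
  have h6 := neg_abs_le (u 0)
  have h7 := le_abs_self (u 0)
  have h8 : 0 ≤ κ / 2 * (x - 0) ^ 2 := by positivity
  have h9 : 0 ≤ |u 0| * x ^ 2 := by positivity
  have h10 : 0 ≤ K * x ^ 2 := by positivity
  simp only [sub_zero] at *
  rw [abs_le]
  constructor <;> nlinarith

theorem deriv_sq_le (h : IsNicePotential κ K u v) (hκ : 0 ≤ κ) :
    ∃ C, 0 ≤ C ∧ ∀ x, v x ^ 2 ≤ C * (1 + x ^ 2) := by
  refine ⟨2 * v 0 ^ 2 + 2 * K ^ 2, by positivity, fun x => ?_⟩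
  have h1 := h.abs_sub_le hκ x 0
  have h2 : (v x - v 0) ^ 2 ≤ K ^ 2 * x ^ 2 := by
    rw [← sq_abs (v x - v 0), ← sq_abs x, ← mul_pow]
    simp only [sub_zero] at h1
    gcongr
  nlinarith [sq_nonneg (v x - 2 * v 0), mul_nonneg (sq_nonneg (v 0)) (sq_nonneg x), sq_nonneg K]

end IsNicePotential

/-- A function dominated below by a nondegenerate quadratic has a density with second moments. -/
theorem integrable_mul_exp_neg_of_quadratic {W φ : ℝ → ℝ} {c₀ c₁ κ C : ℝ} (hκ : 0 < κ)
    (hW : Measurable W) (hlow : ∀ x, c₀ + c₁ * x + κ / 2 * x ^ 2 ≤ W x)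
    (hφ : AEStronglyMeasurable φ) (hb : ∀ x, |φ x| ≤ C * (1 + x ^ 2)) :
    Integrable fun x => φ x * Real.exp (-W x) := by
  have hC : 0 ≤ C := by have := (abs_nonneg _).trans (hb 0); simpa using this
  have h0 : Integrable fun x : ℝ => Real.exp (-(κ / 4) * x ^ 2) :=
    integrable_exp_neg_mul_sq (by positivity)
  have h2 : Integrable fun x : ℝ => x ^ 2 * Real.exp (-(κ / 4) * x ^ 2) := by
    have := integrable_rpow_mul_exp_neg_mul_sq (b := κ / 4) (s := 2) (by positivity) (by norm_num)
    simpa using this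
  have hInt := ((h0.add h2).const_mul (C * Real.exp (c₁ ^ 2 / κ - c₀)))
  refine hInt.mono' (hφ.mul (by fun_prop)) (Filter.Eventually.of_forall fun x => ?_)
  rw [norm_mul, Real.norm_eq_abs, Real.norm_eq_abs, Real.abs_exp]
  have hexp : Real.exp (-W x) ≤ Real.exp (c₁ ^ 2 / κ - c₀) * Real.exp (-(κ / 4) * x ^ 2) := by
    rw [← Real.exp_add, Real.exp_le_exp]
    have h3 := hlow x
    have h4 : 0 ≤ (c₁ + κ / 2 * x) ^ 2 / κ := by positivity
    have h5 : (c₁ + κ / 2 * x) ^ 2 / κ = c₁ ^ 2 / κ + c₁ * x + κ / 4 * x ^ 2 := by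
      field_simp; ring
    linarith
  calc |φ x| * Real.exp (-W x)
      ≤ (C * (1 + x ^ 2)) * (Real.exp (c₁ ^ 2 / κ - c₀) * Real.exp (-(κ / 4) * x ^ 2)) :=
        mul_le_mul (hb x) hexp (Real.exp_pos _).le (by positivity)
    _ = _ := by simp only [Pi.add_apply]; ring

theorem integrable_densityMeasure_iff {u φ : ℝ → ℝ} (hu : Measurable u) :
    Integrable φ (densityMeasure u) ↔ Integrable fun x => φ x * Real.exp (-u x) := by
  rw [densityMeasure, integrable_withDensity_iff (by fun_prop) (by simp)]
  simp [ENNReal.toReal_ofReal (Real.exp_pos _).le]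

theorem integral_densityMeasure {u φ : ℝ → ℝ} (hu : Measurable u) :
    ∫ x, φ x ∂densityMeasure u = ∫ x, φ x * Real.exp (-u x) := by
  rw [densityMeasure, integral_withDensity_eq_integral_toReal_smul (by fun_prop) (by simp)]
  simp [ENNReal.toReal_ofReal (Real.exp_pos _).le, mul_comm]

namespace IsNicePotential

variable {κ K : ℝ} {u v : ℝ → ℝ}

theorem integrable (h : IsNicePotential κ K u v) (hκ : 0 < κ) {φ : ℝ → ℝ} {C : ℝ}
    (hφ : Measurable φ) (hb : ∀ x, |φ x| ≤ C * (1 + x ^ 2)) :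
    Integrable φ (densityMeasure u) := by
  rw [integrable_densityMeasure_iff h.continuous.measurable]
  refine integrable_mul_exp_neg_of_quadratic (c₀ := u 0) (c₁ := v 0) hκ h.continuous.measurable
    (fun x => ?_) hφ.aestronglyMeasurable hb
  simpa using h.lower_bound 0 x

theorem isProbabilityMeasure (h : IsNicePotential κ K u v) :
    IsProbabilityMeasure (densityMeasure u) := by
  have hInt : Integrable fun x => Real.exp (-u x) := by
    by_contra hn
    have := integral_undef hn
    rw [h.integral_exp] at this
    exact one_ne_zero this
  constructor
  rw [densityMeasure, withDensity_apply _ MeasurableSet.univ, Measure.restrict_univ,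
    ← ofReal_integral_eq_lintegral_ofReal hInt (Filter.Eventually.of_forall fun x =>
      (Real.exp_pos _).le), h.integral_exp, ENNReal.ofReal_one]

theorem memLp_of_sq_le (h : IsNicePotential κ K u v) (hκ : 0 < κ) {φ : ℝ → ℝ} {C : ℝ}
    (hφ : Measurable φ) (hb : ∀ x, φ x ^ 2 ≤ C * (1 + x ^ 2)) :
    MemLp φ 2 (densityMeasure u) := by
  rw [memLp_two_iff_integrable_sq hφ.aestronglyMeasurable]
  exact h.integrable hκ (hφ.pow_const 2) fun x => by rw [abs_of_nonneg (sq_nonneg _)]; exact hb x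

/-- The minimizer of a nice potential. -/
theorem exists_deriv_eq_zero (h : IsNicePotential κ K u v) (hκ : 0 < κ) : ∃ m, v m = 0 := by
  have hc := h.continuous_deriv hκ.le
  have h1 : 0 ≤ v (|v 0| / κ) := by
    have := h.lower 0 (|v 0| / κ) (by positivity)
    rw [sub_zero, mul_div_cancel₀ _ hκ.ne'] at this
    linarith [neg_abs_le (v 0)]
  have h2 : v (-(|v 0| / κ)) ≤ 0 := by
    have := h.lower (-(|v 0| / κ)) 0 (by simp; positivity)
    rw [zero_sub, neg_neg, mul_div_cancel₀ _ hκ.ne'] at this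
    linarith [le_abs_self (v 0)]
  have := intermediate_value_univ (-(|v 0| / κ)) (|v 0| / κ) hc ⟨h2, h1⟩
  exact this

end IsNicePotential

section CDF

variable {f : ℝ → ℝ}

theorem hasDerivAt_setIntegral_Iic (hf : Continuous f) (hi : Integrable f) (x : ℝ) :
    HasDerivAt (fun x => ∫ t in Iic x, f t) (f x) x := by
  have h1 : (fun y => ∫ t in Iic y, f t) = fun y => (∫ t in Iic x, f t) + ∫ t in x..y, f t := by
    ext y
    rw [← intervalIntegral.integral_Iic_sub_Iic hi.integrableOn hi.integrableOn]
    ring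
  rw [h1]
  exact (intervalIntegral.integral_hasDerivAt_right (hf.intervalIntegrable _ _)
    (hf.stronglyMeasurableAtFilter _ _) hf.continuousAt).const_add _

theorem strictMono_setIntegral_Iic (hf : Continuous f) (hi : Integrable f) (hpos : ∀ x, 0 < f x) :
    StrictMono fun x => ∫ t in Iic x, f t :=
  strictMono_of_deriv_pos fun x => by
    rw [(hasDerivAt_setIntegral_Iic hf hi x).deriv]; exact hpos x

theorem range_setIntegral_Iic (hf : Continuous f) (hi : Integrable f) (hpos : ∀ x, 0 < f x) :
    range (fun x => ∫ t in Iic x, f t) = Ioo 0 (∫ t, f t) := by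
  have hmono := strictMono_setIntegral_Iic hf hi hpos
  have htop : Tendsto (fun x => ∫ t in Iic x, f t) atTop (𝓝 (∫ t, f t)) :=
    (aecover_Iic tendsto_id).integral_tendsto_of_countably_generated hi
  have hsplit : ∀ x, ∫ t in Iic x, f t = (∫ t, f t) - ∫ t in Ioi x, f t := fun x => by
    rw [← intervalIntegral.integral_Iic_add_Ioi hi.integrableOn hi.integrableOn (b := x)]
    ring
  have hbot : Tendsto (fun x => ∫ t in Iic x, f t) atBot (𝓝 0) := by
    have := ((aecover_Ioi tendsto_id).integral_tendsto_of_countably_generated hi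
      (μ := volume)).const_sub (∫ t, f t)
    rw [sub_self] at this
    exact this.congr fun x => (hsplit x).symm
  have hcont : Continuous fun x => ∫ t in Iic x, f t :=
    continuous_iff_continuousAt.2 fun x => (hasDerivAt_setIntegral_Iic hf hi x).continuousAt
  ext y
  constructor
  · rintro ⟨x, rfl⟩
    refine ⟨?_, ?_⟩
    · exact lt_of_le_of_lt (setIntegral_nonneg measurableSet_Iic fun t _ => (hpos t).le)
        (hmono (sub_one_lt x))
    · exact lt_of_lt_of_le (hmono (lt_add_one x)) (hmono.monotone.ge_of_tendsto htop _)
  · rintro ⟨h0, h1⟩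
    obtain ⟨a, ha⟩ := (hbot.eventually (gt_mem_nhds h0)).exists
    obtain ⟨b, hb⟩ := (htop.eventually (lt_mem_nhds h1)).exists
    exact mem_range_of_exists_le_of_exists_ge hcont ⟨a, ha.le⟩ ⟨b, hb.le⟩

end CDF

/-- Monotone transport between positive continuous densities on the line. -/
theorem exists_transport {f g : ℝ → ℝ} (hf : Continuous f) (hg : Continuous g)
    (hfi : Integrable f) (hgi : Integrable g) (hfpos : ∀ x, 0 < f x) (hgpos : ∀ x, 0 < g x)
    (heq : ∫ x, f x = ∫ x, g x) : ∃ T : ℝ → ℝ, ∀ x, HasDerivAt T (f x / g (T x)) x := by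
  set F := fun x => ∫ t in Iic x, f t with hF
  set G := fun x => ∫ t in Iic x, g t with hG
  have hrange : range F = range G := by
    rw [hF, hG, range_setIntegral_Iic hf hfi hfpos, range_setIntegral_Iic hg hgi hgpos, heq]
  have hFm : StrictMono F := strictMono_setIntegral_Iic hf hfi hfpos
  have hGm : StrictMono G := strictMono_setIntegral_Iic hg hgi hgpos
  have hex : ∀ x, ∃ y, G y = F x := fun x => by
    have h : F x ∈ range G := hrange ▸ mem_range_self x
    exact h
  choose T hT using hex
  have hTm : StrictMono T := fun x y hxy => by
    rw [← hGm.lt_iff_lt, hT, hT]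
    exact hFm hxy
  have hTs : Function.Surjective T := fun y => by
    obtain ⟨x, hx⟩ : G y ∈ range F := hrange ▸ mem_range_self y
    exact ⟨x, hGm.injective (by rw [hT, hx])⟩
  have hTc : Continuous T := hTm.monotone.continuous_of_surjective hTs
  refine ⟨T, fun x => ?_⟩
  rw [hasDerivAt_iff_tendsto_slope]
  have h1 := (hasDerivAt_setIntegral_Iic hf hfi x).tendsto_slope
  have h2 := (hasDerivAt_setIntegral_Iic hg hgi (T x)).tendsto_slope
  have h3 : Tendsto T (𝓝[≠] x) (𝓝[≠] (T x)) :=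
    tendsto_nhdsWithin_of_tendsto_nhds_of_eventually_within _
      (hTc.continuousAt.tendsto.mono_left nhdsWithin_le_nhds)
      (eventually_nhdsWithin_of_forall fun y hy => hTm.injective.ne hy)
  refine (h1.div (h2.comp h3) (hgpos _).ne').congr' ?_
  filter_upwards [self_mem_nhdsWithin] with y hy
  have hne : T y - T x ≠ 0 := sub_ne_zero.2 (hTm.injective.ne hy)
  have hne' : y - x ≠ 0 := sub_ne_zero.2 hy
  have hne2 : F y - F x ≠ 0 := sub_ne_zero.2 (hFm.injective.ne hy)
  change slope F x y / slope G (T x) (T y) = slope T x y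
  rw [slope_def_field, slope_def_field, slope_def_field, hT, hT]
  field_simp

/-- A minorant of the derivative of an integrable function has nonpositive integral. -/
theorem integral_nonpos_of_le_deriv {H H' q : ℝ → ℝ} (hH : ∀ x, HasDerivAt H (H' x) x)
    (hc : Continuous H') (hi : Integrable H) (hq : Integrable q) (hle : q ≤ᵐ[volume] H') :
    ∫ x, q x ≤ 0 := by
  by_contra! hpos
  have hconv : Tendsto (fun p : ℝ × ℝ => ∫ x in p.1..p.2, q x) (atBot ×ˢ atTop)
      (𝓝 (∫ x, q x)) :=
    intervalIntegral_tendsto_integral hq tendsto_fst tendsto_snd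
  have hev := hconv.eventually (lt_mem_nhds (half_lt_self hpos))
  obtain ⟨P, hP, Q, hQ, hPQ⟩ := eventually_prod_iff.1 hev
  obtain ⟨A, hA⟩ := eventually_atBot.1 hP
  obtain ⟨B, hB⟩ := eventually_atTop.1 hQ
  have key : ∀ a ≤ min A 0, ∀ b ≥ max B 0, (∫ x, q x) / 2 < H b - H a := by
    intro a ha b hb
    have hab : a ≤ b := (ha.trans (min_le_right _ _)).trans ((le_max_right _ _).trans hb)
    refine (hPQ (hA a (ha.trans (min_le_left _ _))) (hB b ((le_max_left _ _).trans hb))).trans_le ?_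
    rw [← intervalIntegral.integral_eq_sub_of_hasDerivAt (fun x _ => hH x)
      (hc.intervalIntegrable _ _)]
    exact intervalIntegral.integral_mono_ae hab hq.intervalIntegrable
      (hc.intervalIntegrable _ _) hle
  have hfin := hi.measure_norm_ge_lt_top (ε := (∫ x, q x) / 4) (by positivity)
  by_cases hex : ∃ b ≥ max B 0, H b < (∫ x, q x) / 4
  · obtain ⟨b, hb, hlt⟩ := hex
    have : Iic (min A 0) ⊆ {x | (∫ x, q x) / 4 ≤ ‖H x‖} := fun a ha => by
      have := key a ha b hb
      rw [mem_ofPred_eq, Real.norm_eq_abs]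
      linarith [neg_abs_le (H a)]
    exact absurd ((measure_mono this).trans_lt hfin) (by simp)
  · push Not at hex
    have : Ici (max B 0) ⊆ {x | (∫ x, q x) / 4 ≤ ‖H x‖} := fun b hb => by
      rw [mem_ofPred_eq, Real.norm_eq_abs]
      exact (hex b hb).trans (le_abs_self _)
    exact absurd ((measure_mono this).trans_lt hfin) (by simp)

/-- One-dimensional logarithmic Sobolev inequality in dual form: the log-partition function of a
potential `W` lying above the paraboloids of curvature `κ` with data `Φ`, `p`. -/
theorem log_integral_exp_neg_le {κ₀ κ K : ℝ} {u v W Φ p : ℝ → ℝ} (hκ₀ : 0 < κ₀) (hκ : 0 < κ)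
    (h : IsNicePotential κ₀ K u v) (hW : Continuous W)
    (hle : ∀ᵐ x ∂densityMeasure u, ∀ y, Φ x + p x * (y - x) + κ / 2 * (y - x) ^ 2 ≤ W y)
    (hΦ : Integrable Φ (densityMeasure u)) (hp : MemLp p 2 (densityMeasure u)) :
    Real.log (∫ x, Real.exp (-W x)) ≤
      ∫ x, (u x - Φ x + (v x - p x) ^ 2 / (2 * κ)) ∂densityMeasure u := by
  have := h.isProbabilityMeasure
  have hum : Measurable u := h.continuous.measurable
  obtain ⟨x₀, hx₀⟩ := hle.exists
  have hlow : ∀ y, (Φ x₀ - p x₀ * x₀ + κ / 2 * x₀ ^ 2) + (p x₀ - κ * x₀) * y + κ / 2 * y ^ 2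
      ≤ W y := fun y => le_trans (le_of_eq (by ring)) (hx₀ y)
  have hWi : Integrable fun y => Real.exp (-W y) := by
    have := integrable_mul_exp_neg_of_quadratic (φ := fun _ => 1) (C := 1) hκ hW.measurable hlow
      (by fun_prop) (fun x => by simp; positivity)
    simpa using this
  have hWi1 : Integrable fun y => y * Real.exp (-W y) :=
    integrable_mul_exp_neg_of_quadratic (φ := fun y => y) (C := 1) hκ hW.measurable hlow
      (by fun_prop) (fun x => abs_le.2
        ⟨by nlinarith [sq_nonneg (x + 1)], by nlinarith [sq_nonneg (x - 1)]⟩)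
  set Z := ∫ y, Real.exp (-W y) with hZ
  have hZpos : 0 < Z := integral_exp_pos hWi
  have hui : Integrable fun x => Real.exp (-u x) := by
    have := (integrable_densityMeasure_iff (φ := fun _ => (1 : ℝ)) hum).1 (integrable_const _)
    simpa using this
  obtain ⟨T, hT⟩ := exists_transport (f := fun x => Z * Real.exp (-u x))
    (g := fun y => Real.exp (-W y)) (by have := h.continuous; fun_prop) (by fun_prop)
    (hui.const_mul Z) hWi (fun x => by positivity) (fun x => by positivity)
    (by rw [integral_const_mul, h.integral_exp, mul_one])
  have hTc : Continuous T := continuous_iff_continuousAt.2 fun x => (hT x).continuousAt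
  have hTi : Integrable fun x => T x * Real.exp (-u x) := by
    have hTm : StrictMono T := strictMono_of_deriv_pos fun x => by rw [(hT x).deriv]; positivity
    have := (integrableOn_image_iff_integrableOn_abs_deriv_smul MeasurableSet.univ
      (fun x _ => (hT x).hasDerivWithinAt) hTm.injective.injOn
      (fun y => y * Real.exp (-W y))).1 hWi1.integrableOn
    rw [integrableOn_univ] at this
    refine (this.const_mul Z⁻¹).congr (Eventually.of_forall fun x => ?_)
    simp only [smul_eq_mul]
    rw [abs_of_pos (by positivity)]
    field_simp
  set H := fun x => (T x - x) * Real.exp (-u x) with hHdef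
  have hH : ∀ x, HasDerivAt H ((Z * Real.exp (-u x) / Real.exp (-W (T x)) - 1) * Real.exp (-u x)
      + (T x - x) * (Real.exp (-u x) * -v x)) x := fun x =>
    ((hT x).sub (hasDerivAt_id x)).mul (h.hasDerivAt x).neg.exp
  have hvi : MemLp v 2 (densityMeasure u) := by
    obtain ⟨C, -, hC⟩ := h.deriv_sq_le hκ₀.le
    exact h.memLp_of_sq_le hκ₀ (h.continuous_deriv hκ₀.le).measurable hC
  have hu1 : Integrable u (densityMeasure u) := by
    obtain ⟨C, -, hC⟩ := h.abs_le_quadratic hκ₀.le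
    exact h.integrable hκ₀ hum hC
  set R := fun x => u x - Φ x + (v x - p x) ^ 2 / (2 * κ) with hR
  have hRi : Integrable R (densityMeasure u) :=
    (hu1.sub hΦ).add ((hvi.sub hp).integrable_sq.div_const _)
  have hq : Integrable (fun x => (Real.log Z - R x)) (densityMeasure u) :=
    (integrable_const _).sub hRi
  have hac : (volume : Measure ℝ) ≪ densityMeasure u :=
    withDensity_absolutelyContinuous' (by fun_prop)
      (Eventually.of_forall fun x => by simp [Real.exp_pos])
  have hmain := integral_nonpos_of_le_deriv hH
    (by have := h.continuous; have := h.continuous_deriv hκ₀.le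
        exact ((((continuous_const.mul (by fun_prop)).div (by fun_prop)
          (fun x => (Real.exp_pos _).ne')).sub continuous_const).mul (by fun_prop)).add
          (by fun_prop))
    (by
      have hxi : Integrable fun x : ℝ => x * Real.exp (-u x) :=
        (integrable_densityMeasure_iff hum).1 (h.integrable hκ₀ (C := 1) measurable_id
          fun x => abs_le.2
            ⟨by simp; nlinarith [sq_nonneg (x + 1)], by simp; nlinarith [sq_nonneg (x - 1)]⟩)
      refine (hTi.sub hxi).congr (Eventually.of_forall fun x => ?_)
      simp only [hHdef, Pi.sub_apply]; ring)
    ((integrable_densityMeasure_iff hum).1 hq) (by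
      filter_upwards [hac hle] with x hx
      have hT' : 0 < Z * Real.exp (-u x) / Real.exp (-W (T x)) := by positivity
      have h1 := Real.log_le_sub_one_of_pos hT'
      rw [Real.log_div (by positivity) (by positivity), Real.log_mul hZpos.ne' (by positivity),
        Real.log_exp, Real.log_exp] at h1
      have h2 := hx (T x)
      have h3 : (v x - p x) ^ 2 / (2 * κ) - (v x - p x) * (T x - x) + κ / 2 * (T x - x) ^ 2
          = (v x - p x - κ * (T x - x)) ^ 2 / (2 * κ) := by field_simp; ring
      have h4 : 0 ≤ (v x - p x - κ * (T x - x)) ^ 2 / (2 * κ) := by positivity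
      have h5 : Real.log Z - R x ≤ (Z * Real.exp (-u x) / Real.exp (-W (T x)) - 1)
          + (T x - x) * -v x := by
        simp only [hR]; linarith
      calc (Real.log Z - R x) * Real.exp (-u x) ≤ _ :=
            mul_le_mul_of_nonneg_right h5 (Real.exp_pos _).le
        _ = _ := by ring)
  rw [← integral_densityMeasure hum (φ := fun x => Real.log Z - R x),
    integral_sub (integrable_const _) hRi] at hmain
  simp at hmain
  exact hmain

/-- Insertion of a coordinate, as a measurable equivalence. -/
noncomputable def insertEquiv {d : ℕ} (i : Fin (d + 1)) :
    ((Fin d → ℝ) × ℝ) ≃ᵐ (Fin (d + 1) → ℝ) :=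
  MeasurableEquiv.prodComm.trans (MeasurableEquiv.piFinSuccAbove (fun _ => ℝ) i).symm

section Insert

variable {d : ℕ} (i : Fin (d + 1)) (ν : Fin (d + 1) → Measure ℝ) [∀ i, SigmaFinite (ν i)]

theorem measurePreserving_insertEquiv :
    MeasurePreserving (insertEquiv i)
      ((Measure.pi fun j => ν (i.succAbove j)).prod (ν i)) (Measure.pi ν) :=
  (measurePreserving_piFinSuccAbove ν i).symm.comp Measure.measurePreserving_swap

variable {ν}

theorem integrable_insertNth {F : (Fin (d + 1) → ℝ) → ℝ} (hF : Integrable F (Measure.pi ν)) :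
    Integrable (fun z : (Fin d → ℝ) × ℝ => F (i.insertNth z.2 z.1))
      ((Measure.pi fun j => ν (i.succAbove j)).prod (ν i)) :=
  (measurePreserving_insertEquiv i ν).integrable_comp_of_integrable hF

theorem integral_insertNth_prod (F : (Fin (d + 1) → ℝ) → ℝ) :
    ∫ x, F x ∂Measure.pi ν = ∫ z : (Fin d → ℝ) × ℝ, F (i.insertNth z.2 z.1)
      ∂((Measure.pi fun j => ν (i.succAbove j)).prod (ν i)) :=
  ((measurePreserving_insertEquiv i ν).integral_comp' F).symm

theorem integral_insertNth {F : (Fin (d + 1) → ℝ) → ℝ} (hF : Integrable F (Measure.pi ν)) :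
    ∫ x, F x ∂Measure.pi ν =
      ∫ y, ∫ t, F (i.insertNth t y) ∂ν i ∂(Measure.pi fun j => ν (i.succAbove j)) := by
  rw [integral_insertNth_prod i, integral_prod _ (integrable_insertNth i hF)]

theorem integral_insertNth_symm {F : (Fin (d + 1) → ℝ) → ℝ} (hF : Integrable F (Measure.pi ν)) :
    ∫ x, F x ∂Measure.pi ν =
      ∫ t, ∫ y, F (i.insertNth t y) ∂(Measure.pi fun j => ν (i.succAbove j)) ∂ν i := by
  rw [integral_insertNth_prod i, integral_prod_symm _ (integrable_insertNth i hF)]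

theorem ae_ae_insertNth {P : (Fin (d + 1) → ℝ) → Prop} (hP : ∀ᵐ x ∂Measure.pi ν, P x) :
    ∀ᵐ y ∂(Measure.pi fun j => ν (i.succAbove j)), ∀ᵐ t ∂ν i, P (i.insertNth t y) :=
  Measure.ae_ae_of_ae_prod ((measurePreserving_insertEquiv i ν).quasiMeasurePreserving.ae hP)

end Insert

theorem continuous_insertNth {d : ℕ} (i : Fin (d + 1)) :
    Continuous fun z : (Fin d → ℝ) × ℝ => (i.insertNth z.2 z.1 : Fin (d + 1) → ℝ) :=
  Continuous.finInsertNth (A := fun _ => ℝ) i continuous_snd continuous_fst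

theorem sq_integral_le {Ω : Type*} [MeasurableSpace Ω] {μ : Measure Ω} [IsProbabilityMeasure μ]
    {f : Ω → ℝ} (hf : MemLp f 2 μ) : (∫ x, f x ∂μ) ^ 2 ≤ ∫ x, f x ^ 2 ∂μ := by
  have := variance_nonneg f μ
  rw [variance_eq_sub hf] at this
  simpa using this

/-- Functions above a paraboloid have integrable exponential. -/
theorem integrable_exp_neg_of_paraboloid {d : ℕ} {W : (Fin d → ℝ) → ℝ} {κ c : ℝ} {q x : Fin d → ℝ}
    (hκ : 0 < κ) (hW : Measurable W)
    (hle : ∀ y, c + ∑ i, q i * (y i - x i) + κ / 2 * ∑ i, (y i - x i) ^ 2 ≤ W y) :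
    Integrable fun y => Real.exp (-W y) := by
  have h1 : ∀ i, Integrable fun t : ℝ => Real.exp (-(q i * (t - x i) + κ / 2 * (t - x i) ^ 2)) := by
    intro i
    have := integrable_mul_exp_neg_of_quadratic (φ := fun _ => 1)
      (W := fun t => q i * (t - x i) + κ / 2 * (t - x i) ^ 2) (C := 1)
      (c₀ := -q i * x i + κ / 2 * x i ^ 2) (c₁ := q i - κ * x i) hκ (by fun_prop)
      (fun t => le_of_eq (by ring)) (by fun_prop) (fun x => by simp; positivity)
    simpa using this
  have h2 := (Integrable.fintype_prod h1).const_mul (Real.exp (-c))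
  refine h2.mono' (by fun_prop) (Eventually.of_forall fun y => ?_)
  rw [Real.norm_eq_abs, abs_of_pos (Real.exp_pos _), ← Real.exp_sum, ← Real.exp_add]
  apply Real.exp_le_exp.2
  have := hle y
  simp only [Finset.sum_neg_distrib, Finset.sum_add_distrib, ← Finset.mul_sum]
  linarith

theorem integral_insertNth_volume {d : ℕ} (i : Fin (d + 1)) {F : (Fin (d + 1) → ℝ) → ℝ}
    (hF : Integrable F) : ∫ x, F x = ∫ y : Fin d → ℝ, ∫ t, F (i.insertNth t y) :=
  integral_insertNth (ν := fun _ => volume) i hF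

/-- The logarithmic Sobolev inequality of `log_integral_exp_neg_le`, tensorized. -/
theorem log_integral_exp_neg_pi_le {κ₀ κ K : ℝ} (hκ₀ : 0 < κ₀) (hκ : 0 < κ) :
    ∀ (d : ℕ) {u v : Fin d → ℝ → ℝ} (_ : ∀ i, IsNicePotential κ₀ K (u i) (v i))
      {W Φ : (Fin d → ℝ) → ℝ} {p : Fin d → (Fin d → ℝ) → ℝ} (_ : Continuous W)
      (_ : ∀ᵐ x ∂Measure.pi fun i => densityMeasure (u i), ∀ y,
        Φ x + ∑ i, p i x * (y i - x i) + κ / 2 * ∑ i, (y i - x i) ^ 2 ≤ W y)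
      (_ : Integrable Φ (Measure.pi fun i => densityMeasure (u i)))
      (_ : ∀ i, MemLp (p i) 2 (Measure.pi fun i => densityMeasure (u i))),
      Real.log (∫ x, Real.exp (-W x)) ≤
        ∫ x, (∑ i, u i (x i) - Φ x + ∑ i, (v i (x i) - p i x) ^ 2 / (2 * κ))
          ∂Measure.pi fun i => densityMeasure (u i)
  | 0, u, v, _, W, Φ, p, _, hle, _, _ => by
    rw [volume_pi, Measure.pi_of_empty, Measure.pi_of_empty, integral_dirac, integral_dirac]
    rw [Measure.pi_of_empty _ isEmptyElim, ae_dirac_eq] at hle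
    have := (show ∀ y, _ from hle) isEmptyElim
    simpa using this
  | d + 1, u, v, h, W, Φ, p, hW, hle, hΦ, hp => by
    have hprob : ∀ i, IsProbabilityMeasure (densityMeasure (u i)) :=
      fun i => (h i).isProbabilityMeasure
    set i₀ : Fin (d + 1) := 0
    set ν := Measure.pi fun i => densityMeasure (u i) with hν
    set ν' := Measure.pi fun j => densityMeasure (u (i₀.succAbove j)) with hν'
    obtain ⟨x₀, hx₀⟩ := hle.exists
    have hWi : Integrable fun y => Real.exp (-W y) :=
      integrable_exp_neg_of_paraboloid hκ hW.measurable hx₀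
    have hui : ∀ i, MemLp (u i) 1 (densityMeasure (u i)) := fun i => by
      obtain ⟨C, -, hC⟩ := (h i).abs_le_quadratic hκ₀.le
      exact memLp_one_iff_integrable.2 ((h i).integrable hκ₀ (h i).continuous.measurable hC)
    have hvi : ∀ i, MemLp (v i) 2 (densityMeasure (u i)) := fun i => by
      obtain ⟨C, -, hC⟩ := (h i).deriv_sq_le hκ₀.le
      exact (h i).memLp_of_sq_le hκ₀ ((h i).continuous_deriv hκ₀.le).measurable hC
    have hsplit : ∀ y : Fin d → ℝ, ∀ t : ℝ, Φ x₀ + p i₀ x₀ * (t - x₀ i₀)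
        + κ / 2 * (t - x₀ i₀) ^ 2 - ∑ j, p (i₀.succAbove j) x₀ ^ 2 / (2 * κ)
        ≤ W (i₀.insertNth t y) := by
      intro y t
      refine le_trans ?_ (hx₀ (i₀.insertNth t y))
      rw [Fin.sum_univ_succAbove _ i₀, Fin.sum_univ_succAbove _ i₀]
      simp only [Fin.insertNth_apply_same, Fin.insertNth_apply_succAbove]
      have : 0 ≤ ∑ j, (p (i₀.succAbove j) x₀ * (y j - x₀ (i₀.succAbove j))
          + κ / 2 * (y j - x₀ (i₀.succAbove j)) ^ 2 + p (i₀.succAbove j) x₀ ^ 2 / (2 * κ)) := by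
        refine Finset.sum_nonneg fun j _ => ?_
        have : p (i₀.succAbove j) x₀ * (y j - x₀ (i₀.succAbove j))
          + κ / 2 * (y j - x₀ (i₀.succAbove j)) ^ 2 + p (i₀.succAbove j) x₀ ^ 2 / (2 * κ)
          = (κ * (y j - x₀ (i₀.succAbove j)) + p (i₀.succAbove j) x₀) ^ 2 / (2 * κ) := by
          field_simp; ring
        rw [this]; positivity
      rw [Finset.sum_add_distrib, Finset.sum_add_distrib, ← Finset.mul_sum] at this
      linarith
    have hbound : Integrable fun t : ℝ => Real.exp (-(Φ x₀ + p i₀ x₀ * (t - x₀ i₀)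
        + κ / 2 * (t - x₀ i₀) ^ 2 - ∑ j, p (i₀.succAbove j) x₀ ^ 2 / (2 * κ))) := by
      have := integrable_mul_exp_neg_of_quadratic (φ := fun _ => 1)
        (W := fun t => (Φ x₀ + p i₀ x₀ * (t - x₀ i₀)
        + κ / 2 * (t - x₀ i₀) ^ 2 - ∑ j, p (i₀.succAbove j) x₀ ^ 2 / (2 * κ))) (C := 1)
        (c₀ := Φ x₀ - p i₀ x₀ * x₀ i₀ + κ / 2 * x₀ i₀ ^ 2
          - ∑ j, p (i₀.succAbove j) x₀ ^ 2 / (2 * κ)) (c₁ := p i₀ x₀ - κ * x₀ i₀)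
        hκ (by fun_prop)
        (fun t => le_of_eq (by ring)) (by fun_prop) (fun x => by simp; positivity)
      simpa using this
    have hWc := hW.comp (continuous_insertNth i₀)
    have hWt : ∀ y : Fin d → ℝ, Continuous fun t => W (i₀.insertNth t y) := fun y =>
      hWc.comp (Continuous.prodMk_right y)
    have hWy : ∀ t, Continuous fun y : Fin d → ℝ => W (i₀.insertNth t y) := fun t =>
      hWc.comp (Continuous.prodMk_left t)
    have hZi : ∀ y : Fin d → ℝ, Integrable fun t => Real.exp (-W (i₀.insertNth t y)) := fun y =>
      hbound.mono' (by have := hWt y; fun_prop) (Eventually.of_forall fun t => by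
        rw [Real.norm_eq_abs, abs_of_pos (Real.exp_pos _)]
        exact Real.exp_le_exp.2 (neg_le_neg (hsplit y t)))
    set Z : (Fin d → ℝ) → ℝ := fun y => ∫ t, Real.exp (-W (i₀.insertNth t y)) with hZ
    have hZpos : ∀ y, 0 < Z y := fun y => integral_exp_pos (hZi y)
    have hZc : Continuous Z := by
      refine continuous_of_dominated (fun y => by have := hWt y; fun_prop)
        (fun y => Eventually.of_forall fun t => ?_) hbound
        (Eventually.of_forall fun t => by have := hWy t; fun_prop)
      rw [Real.norm_eq_abs, abs_of_pos (Real.exp_pos _)]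
      exact Real.exp_le_exp.2 (neg_le_neg (hsplit y t))
    have hIH := log_integral_exp_neg_pi_le hκ₀ hκ d (fun j => h (i₀.succAbove j))
      (W := fun y => -Real.log (Z y))
      (Φ := fun y => ∫ t, (Φ (i₀.insertNth t y) - u i₀ t
        - (v i₀ t - p i₀ (i₀.insertNth t y)) ^ 2 / (2 * κ)) ∂densityMeasure (u i₀))
      (p := fun j y => ∫ t, p (i₀.succAbove j) (i₀.insertNth t y) ∂densityMeasure (u i₀))
      (hZc.log fun y => (hZpos y).ne').neg
    have hu0 := h i₀
    have hmp := measurePreserving_insertEquiv i₀ fun i => densityMeasure (u i)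
    have hPhi2 : Integrable (fun z : (Fin d → ℝ) × ℝ => Φ (i₀.insertNth z.2 z.1) - u i₀ z.2
        - (v i₀ z.2 - p i₀ (i₀.insertNth z.2 z.1)) ^ 2 / (2 * κ))
        (ν'.prod (densityMeasure (u i₀))) := by
      refine ((integrable_insertNth i₀ hΦ).sub ?_).sub (Integrable.div_const ?_ _)
      · exact (memLp_one_iff_integrable.1 (hui i₀)).comp_snd ν'
      · refine MemLp.integrable_sq (MemLp.sub ?_ ?_)
        · exact (hvi i₀).comp_measurePreserving measurePreserving_snd
        · exact (hp i₀).comp_measurePreserving hmp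
    have hp2 : ∀ i, MemLp (fun z : (Fin d → ℝ) × ℝ => p i (i₀.insertNth z.2 z.1)) 2
        (ν'.prod (densityMeasure (u i₀))) := fun i => (hp i).comp_measurePreserving hmp
    have hpsec : ∀ i, ∀ᵐ y ∂ν', MemLp (fun t => p i (i₀.insertNth t y)) 2
        (densityMeasure (u i₀)) := fun i => by
      filter_upwards [(hp2 i).integrable_sq.prod_right_ae, (hp2 i).1.prodMk_left] with y h1 h2
      exact (memLp_two_iff_integrable_sq h2).2 h1
    have hpbar : ∀ j, MemLp (fun y => ∫ t, p (i₀.succAbove j) (i₀.insertNth t y)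
        ∂densityMeasure (u i₀)) 2 ν' := fun j => by
      have hm : AEStronglyMeasurable (fun y => ∫ t, p (i₀.succAbove j) (i₀.insertNth t y)
        ∂densityMeasure (u i₀)) ν' := (hp2 (i₀.succAbove j)).1.integral_prod_right'
      rw [memLp_two_iff_integrable_sq hm]
      refine (hp2 (i₀.succAbove j)).integrable_sq.integral_prod_left.mono' (hm.pow 2) ?_
      filter_upwards [hpsec (i₀.succAbove j)] with y hy
      rw [Real.norm_eq_abs, abs_of_nonneg (sq_nonneg _)]
      exact sq_integral_le hy
    have hlog : Real.log (∫ y : Fin d → ℝ, Real.exp (- -Real.log (Z y)))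
        = Real.log (∫ x, Real.exp (-W x)) := by
      congr 1
      rw [integral_insertNth_volume i₀ hWi]
      refine integral_congr_ae (Eventually.of_forall fun y => ?_)
      show Real.exp (- -Real.log (Z y)) = Z y
      rw [neg_neg, Real.exp_log (hZpos y)]
    rw [hlog] at hIH
    have hfull : Integrable (fun x => ∑ i, u i (x i) - Φ x
        + ∑ i, (v i (x i) - p i x) ^ 2 / (2 * κ)) ν := by
      refine Integrable.add (Integrable.sub (integrable_finsetSum _ fun i _ => ?_) hΦ)
        (integrable_finsetSum _ fun i _ => Integrable.div_const (MemLp.integrable_sq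
          (MemLp.sub ?_ (hp i))) _)
      · exact integrable_comp_eval (memLp_one_iff_integrable.1 (hui i))
      · exact (hvi i).comp_measurePreserving (measurePreserving_eval _ i)
    refine (hIH ?_ hPhi2.integral_prod_left hpbar).trans ?_
    · filter_upwards [ae_ae_insertNth i₀ hle, hPhi2.prod_right_ae, hpsec i₀,
        ae_all_iff.2 fun i => hpsec i, (integrable_insertNth i₀ hΦ).prod_right_ae]
        with x hx h1 h2 h3 h4 y
      have hInt : ∀ j, Integrable (fun t => p (i₀.succAbove j) (i₀.insertNth t x))
        (densityMeasure (u i₀)) := fun j => (h3 _).integrable (by norm_num)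
      have := log_integral_exp_neg_le hκ₀ hκ hu0 (hWt y)
        (Φ := fun t => Φ (i₀.insertNth t x) + ∑ j, p (i₀.succAbove j) (i₀.insertNth t x)
          * (y j - x j) + κ / 2 * ∑ j, (y j - x j) ^ 2)
        (p := fun t => p i₀ (i₀.insertNth t x)) (by
          filter_upwards [hx] with t ht s
          have := ht (i₀.insertNth s y)
          rw [Fin.sum_univ_succAbove _ i₀, Fin.sum_univ_succAbove _ i₀] at this
          simp only [Fin.insertNth_apply_same, Fin.insertNth_apply_succAbove] at this
          linarith)
        ((h4.add (integrable_finsetSum _ fun j _ => (hInt j).mul_const _)).add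
          (integrable_const _)) h2
      have h5 : ∫ t, (u i₀ t - (Φ (i₀.insertNth t x) + ∑ j, p (i₀.succAbove j) (i₀.insertNth t x)
          * (y j - x j) + κ / 2 * ∑ j, (y j - x j) ^ 2)
          + (v i₀ t - p i₀ (i₀.insertNth t x)) ^ 2 / (2 * κ)) ∂densityMeasure (u i₀)
          = ∫ t, ((-(∑ j, p (i₀.succAbove j) (i₀.insertNth t x) * (y j - x j)
            + κ / 2 * ∑ j, (y j - x j) ^ 2)) - (Φ (i₀.insertNth t x) - u i₀ t
            - (v i₀ t - p i₀ (i₀.insertNth t x)) ^ 2 / (2 * κ))) ∂densityMeasure (u i₀) := by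
        congr 1; ext t; ring
      have h6 : Integrable (fun t => ∑ j, p (i₀.succAbove j) (i₀.insertNth t x) * (y j - x j)
          + κ / 2 * ∑ j, (y j - x j) ^ 2) (densityMeasure (u i₀)) :=
        (integrable_finsetSum _ fun j _ => (hInt j).mul_const _).add (integrable_const _)
      rw [h5, integral_sub (by exact h6.neg) h1, integral_neg, integral_add (integrable_finsetSum _ fun j _ =>
        (hInt j).mul_const _) (integrable_const _), integral_finsetSum _ fun j _ =>
        (hInt j).mul_const _] at this
      simp only [integral_mul_const, integral_const, probReal_univ, one_smul] at this
      change Real.log (Z y) ≤ _ at this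
      linarith
    · rw [integral_insertNth i₀ hfull]
      have hfull2 := integrable_insertNth i₀ hfull
      refine integral_mono_ae ?_ hfull2.integral_prod_left ?_
      · refine Integrable.add (Integrable.sub (integrable_finsetSum _ fun i _ => ?_)
          hPhi2.integral_prod_left)
          (integrable_finsetSum _ fun i _ => Integrable.div_const (MemLp.integrable_sq
            (MemLp.sub ?_ (hpbar i))) _)
        · exact integrable_comp_eval (memLp_one_iff_integrable.1 (hui _))
        · exact (hvi _).comp_measurePreserving (measurePreserving_eval _ i)
      · filter_upwards [hPhi2.prod_right_ae, ae_all_iff.2 fun i => hpsec i] with x h1 h3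
        have hsq : ∀ j, MemLp (fun t => v (i₀.succAbove j) (x j)
            - p (i₀.succAbove j) (i₀.insertNth t x)) 2 (densityMeasure (u i₀)) := fun j =>
          (memLp_const _).sub (h3 _)
        have hR : ∫ t, (∑ i, u i ((i₀.insertNth t x : Fin (d + 1) → ℝ) i) - Φ (i₀.insertNth t x)
            + ∑ i, (v i ((i₀.insertNth t x : Fin (d + 1) → ℝ) i)
              - p i (i₀.insertNth t x)) ^ 2 / (2 * κ)) ∂densityMeasure (u i₀)
            = ∫ t, (∑ j, u (i₀.succAbove j) (x j) - (Φ (i₀.insertNth t x) - u i₀ t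
            - (v i₀ t - p i₀ (i₀.insertNth t x)) ^ 2 / (2 * κ)) + ∑ j, (v (i₀.succAbove j) (x j)
            - p (i₀.succAbove j) (i₀.insertNth t x)) ^ 2 / (2 * κ)) ∂densityMeasure (u i₀) := by
          congr 1; ext t
          rw [Fin.sum_univ_succAbove _ i₀, Fin.sum_univ_succAbove _ i₀]
          simp only [Fin.insertNth_apply_same, Fin.insertNth_apply_succAbove]
          ring
        rw [hR, integral_add (by exact (integrable_const _).sub h1) (integrable_finsetSum _ fun j _ =>
          (hsq j).integrable_sq.div_const _), integral_sub (integrable_const _) h1,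
          integral_finsetSum _ fun j _ => (hsq j).integrable_sq.div_const _]
        simp only [integral_const, probReal_univ, one_smul]
        refine add_le_add le_rfl (Finset.sum_le_sum fun j _ => ?_)
        rw [integral_div]
        refine div_le_div_of_nonneg_right ?_ (by positivity)
        have := sq_integral_le (hsq j)
        rw [integral_sub (integrable_const _) ((h3 _).integrable (by norm_num))] at this
        simpa using this

theorem sq_sub_le_mul_integral_deriv_sq {φ φ' : ℝ → ℝ} (hφ : ∀ x, HasDerivAt φ (φ' x) x)
    (hc : Continuous φ') (m x : ℝ) :
    (φ x - φ m) ^ 2 ≤ (x - m) * ∫ t in m..x, φ' t ^ 2 := by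
  have hc2 : Continuous fun t => φ' t ^ 2 := by fun_prop
  set P := fun x => ∫ t in m..x, φ' t ^ 2 with hP
  have hPd : ∀ x, HasDerivAt P (φ' x ^ 2) x := fun x =>
    intervalIntegral.integral_hasDerivAt_right (hc2.intervalIntegrable _ _)
      (hc2.stronglyMeasurableAtFilter _ _) hc2.continuousAt
  have hmono : ∀ l : ℝ, Monotone fun y => P y - 2 * l * (φ y - φ m) + l ^ 2 * (y - m) := fun l => by
    refine monotone_of_hasDerivAt_nonneg (f' := fun y => (φ' y - l) ^ 2) (fun y => ?_)
      fun y => sq_nonneg _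
    refine (((hPd y).sub (((hφ y).sub_const (φ m)).const_mul (2 * l))).add
      (((hasDerivAt_id y).sub_const m).const_mul (l ^ 2))).congr_deriv ?_
    ring
  have hP0 : P m = 0 := by simp [hP]
  have key : ∀ l : ℝ, 0 ≤ (x - m) * (P x - 2 * l * (φ x - φ m) + l ^ 2 * (x - m)) := fun l => by
    rcases le_total m x with h | h
    · have := hmono l h
      simp only [hP0, sub_self] at this
      exact mul_nonneg (by linarith) (by linarith)
    · have := hmono l h
      simp only [hP0, sub_self] at this
      exact mul_nonneg_of_nonpos_of_nonpos (by linarith) (by linarith)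
  rcases eq_or_ne x m with rfl | hne
  · simp
  · have h1 := key ((φ x - φ m) / (x - m))
    have h2 : x - m ≠ 0 := sub_ne_zero.2 hne
    have h3 : (x - m) * (P x - 2 * ((φ x - φ m) / (x - m)) * (φ x - φ m)
        + ((φ x - φ m) / (x - m)) ^ 2 * (x - m)) = (x - m) * P x - (φ x - φ m) ^ 2 := by
      field_simp; ring
    linarith

/-- Poincaré inequality for a strongly log-concave density on the line. -/
theorem IsNicePotential.poincare {κ K C : ℝ} {u v φ φ' : ℝ → ℝ} (hκ : 0 < κ)
    (h : IsNicePotential κ K u v) (hφ : ∀ x, HasDerivAt φ (φ' x) x) (hc : Continuous φ')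
    (hC : ∀ x, |φ' x| ≤ C) :
    ∫ x, φ x ^ 2 ∂densityMeasure u - (∫ x, φ x ∂densityMeasure u) ^ 2 ≤
      1 / κ * ∫ x, φ' x ^ 2 ∂densityMeasure u := by
  have := h.isProbabilityMeasure
  have hum : Measurable u := h.continuous.measurable
  obtain ⟨m, hm⟩ := h.exists_deriv_eq_zero hκ
  have hφc : Continuous φ := continuous_iff_continuousAt.2 fun x => (hφ x).continuousAt
  have hC0 : 0 ≤ C := (abs_nonneg _).trans (hC 0)
  have hc2 : Continuous fun t => φ' t ^ 2 := by fun_prop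
  set P := fun x => ∫ t in m..x, φ' t ^ 2 with hP
  have hPd : ∀ x, HasDerivAt P (φ' x ^ 2) x := fun x =>
    intervalIntegral.integral_hasDerivAt_right (hc2.intervalIntegrable _ _)
      (hc2.stronglyMeasurableAtFilter _ _) hc2.continuousAt
  have hPc : Continuous P := continuous_iff_continuousAt.2 fun x => (hPd x).continuousAt
  have hsqC : ∀ x, φ' x ^ 2 ≤ C ^ 2 := fun x => sq_le_sq' (by linarith [abs_le.1 (hC x)])
    (abs_le.1 (hC x)).2
  have hPb : ∀ x, |P x| ≤ C ^ 2 * |x - m| := fun x => by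
    have := intervalIntegral.norm_integral_le_of_norm_le_const (a := m) (b := x)
      (f := fun t => φ' t ^ 2) (C := C ^ 2)
      fun t _ => by rw [Real.norm_eq_abs, abs_of_nonneg (sq_nonneg _)]; exact hsqC t
    exact this
  have hcs : ∀ x, (φ x - φ m) ^ 2 ≤ (x - m) * P x := sq_sub_le_mul_integral_deriv_sq hφ hc m
  have hvP : ∀ x, κ * (φ x - φ m) ^ 2 ≤ P x * v x := fun x => by
    have h0 : 0 ≤ (x - m) * P x := (sq_nonneg _).trans (hcs x)
    refine (mul_le_mul_of_nonneg_left (hcs x) hκ.le).trans ?_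
    rcases lt_trichotomy x m with hx | hx | hx
    · have h1 := h.lower x m hx.le
      have h2 : P x ≤ 0 := by
        by_contra! hpos
        nlinarith
      rw [hm] at h1
      nlinarith
    · subst hx; simp [hP]
    · have h1 := h.lower m x hx.le
      have h2 : 0 ≤ P x := by
        by_contra! hpos
        nlinarith
      rw [hm] at h1
      nlinarith
  have hm2 : ∀ x, |x - m| ≤ (1 + |m|) * (1 + x ^ 2) := fun x => by
    have h1 := abs_sub x m
    have h2 : |x| ≤ 1 + x ^ 2 := by nlinarith [sq_nonneg (|x| - 1), sq_abs x, abs_nonneg x]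
    nlinarith [abs_nonneg m, sq_nonneg x, mul_nonneg (abs_nonneg m) (sq_nonneg x)]
  have hPi : Integrable P (densityMeasure u) := by
    refine h.integrable hκ hPc.measurable (C := C ^ 2 * (1 + |m|)) fun x => ?_
    rw [mul_assoc]
    exact (hPb x).trans (mul_le_mul_of_nonneg_left (hm2 x) (sq_nonneg _))
  have hfi : Integrable (fun x => (φ x - φ m) ^ 2) (densityMeasure u) := by
    refine h.integrable hκ (by fun_prop) (C := C ^ 2 * (2 + 2 * m ^ 2)) fun x => ?_
    rw [abs_of_nonneg (sq_nonneg _)]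
    have h1 : (x - m) * P x ≤ |x - m| * (C ^ 2 * |x - m|) :=
      (le_abs_self _).trans (by rw [abs_mul]; exact mul_le_mul_of_nonneg_left (hPb x) (abs_nonneg _))
    have h2 : |x - m| * (C ^ 2 * |x - m|) = C ^ 2 * (x - m) ^ 2 := by
      rw [← sq_abs (x - m)]; ring
    have h3 : (x - m) ^ 2 ≤ (2 + 2 * m ^ 2) * (1 + x ^ 2) := by
      nlinarith [sq_nonneg (x + m), mul_nonneg (sq_nonneg m) (sq_nonneg x)]
    have := mul_le_mul_of_nonneg_left h3 (sq_nonneg C)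
    linarith [hcs x]
  have hφ'i : Integrable (fun x => φ' x ^ 2) (densityMeasure u) := by
    refine (integrable_const (C ^ 2)).mono' (by fun_prop) (Eventually.of_forall fun x => ?_)
    rw [Real.norm_eq_abs, abs_of_nonneg (sq_nonneg _)]; exact hsqC x
  have hq : Integrable (fun x => κ * (φ x - φ m) ^ 2 - φ' x ^ 2) (densityMeasure u) :=
    (hfi.const_mul κ).sub hφ'i
  have hvc := h.continuous_deriv hκ.le
  have huc := h.continuous
  have hmain := integral_nonpos_of_le_deriv (H := fun x => -(P x * Real.exp (-u x)))
    (H' := fun x => -(φ' x ^ 2 * Real.exp (-u x) + P x * (Real.exp (-u x) * -v x)))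
    (q := fun x => (κ * (φ x - φ m) ^ 2 - φ' x ^ 2) * Real.exp (-u x))
    (fun x => ((hPd x).mul (h.hasDerivAt x).neg.exp).neg) (by fun_prop)
    ((integrable_densityMeasure_iff hum).1 hPi).neg
    ((integrable_densityMeasure_iff hum).1 hq)
    (Eventually.of_forall fun x => by
      have := mul_le_mul_of_nonneg_right (hvP x) (Real.exp_pos (-u x)).le
      show _ ≤ -(φ' x ^ 2 * Real.exp (-u x) + P x * (Real.exp (-u x) * -v x))
      linarith)
  rw [← integral_densityMeasure hum (φ := fun x => κ * (φ x - φ m) ^ 2 - φ' x ^ 2),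
    integral_sub (hfi.const_mul κ) hφ'i, integral_const_mul] at hmain
  have hL : MemLp (fun x => φ x - φ m) 2 (densityMeasure u) :=
    (memLp_two_iff_integrable_sq (by fun_prop)).2 hfi
  have hφL : MemLp φ 2 (densityMeasure u) := by
    have := hL.add (memLp_const (φ m))
    refine (memLp_congr_ae (Eventually.of_forall fun x => ?_)).1 this
    simp
  have hvar : ∫ x, (φ x - φ m) ^ 2 ∂densityMeasure u = ∫ x, φ x ^ 2 ∂densityMeasure u
      - 2 * φ m * (∫ x, φ x ∂densityMeasure u) + φ m ^ 2 := by
    have : (fun x => (φ x - φ m) ^ 2) = fun x => φ x ^ 2 - 2 * φ m * φ x + φ m ^ 2 := by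
      ext x; ring
    have hi := hφL.integrable (by norm_num : (1 : ℝ≥0∞) ≤ 2)
    rw [this, integral_add (by exact hφL.integrable_sq.sub (hi.const_mul _)) (integrable_const _),
      integral_sub hφL.integrable_sq (hi.const_mul _), integral_const_mul]
    simp
  have h4 : ∫ x, (φ x - φ m) ^ 2 ∂densityMeasure u ≤ 1 / κ * ∫ x, φ' x ^ 2 ∂densityMeasure u := by
    rw [one_div, ← div_eq_inv_mul, le_div_iff₀ hκ]; linarith
  nlinarith [sq_nonneg ((∫ x, φ x ∂densityMeasure u) - φ m)]

theorem integrable_pi_of_abs_le {d : ℕ} {κ K : ℝ} (hκ : 0 < κ) {u v : Fin d → ℝ → ℝ}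
    (h : ∀ i, IsNicePotential κ K (u i) (v i)) {F : (Fin d → ℝ) → ℝ} (hF : Continuous F) {C : ℝ}
    (hC : ∀ x, |F x| ≤ C * (1 + ∑ i, x i ^ 2)) :
    Integrable F (Measure.pi fun i => densityMeasure (u i)) := by
  have hprob : ∀ i, IsProbabilityMeasure (densityMeasure (u i)) :=
    fun i => (h i).isProbabilityMeasure
  have h1 : Integrable (fun x : Fin d → ℝ => C * (1 + ∑ i, x i ^ 2))
      (Measure.pi fun i => densityMeasure (u i)) := by
    refine Integrable.const_mul ((integrable_const _).add (integrable_finsetSum _ fun i _ => ?_)) _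
    exact integrable_comp_eval (μ := fun i => densityMeasure (u i)) (i := i) (f := fun t : ℝ => t ^ 2)
      ((h i).integrable hκ (φ := fun t => t ^ 2) (C := 1) (by fun_prop) fun x => by
        rw [abs_of_nonneg (sq_nonneg _)]; linarith)
  exact h1.mono' hF.aestronglyMeasurable (Eventually.of_forall hC)

theorem LipschitzWith.sq_le_quadratic {d : ℕ} {F : (Fin d → ℝ) → ℝ} {L : NNReal}
    (hF : LipschitzWith L F) (x : Fin d → ℝ) :
    F x ^ 2 ≤ (2 * F 0 ^ 2 + 2 * L ^ 2) * (1 + ∑ i, x i ^ 2) := by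
  have h1 : |F x - F 0| ≤ L * ‖x‖ := by
    have := hF.dist_le_mul x 0
    rwa [Real.dist_eq, dist_zero_right] at this
  have h2 : ‖x‖ ^ 2 ≤ ∑ i, x i ^ 2 := by
    have h0 : 0 ≤ ∑ i, x i ^ 2 := Finset.sum_nonneg fun i _ => sq_nonneg _
    refine Real.le_sqrt (norm_nonneg _) h0 |>.1 ((pi_norm_le_iff_of_nonneg (Real.sqrt_nonneg _)).2
      fun i => ?_)
    rw [Real.norm_eq_abs]
    exact Real.abs_le_sqrt (Finset.single_le_sum (f := fun i => x i ^ 2)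
      (fun i _ => sq_nonneg _) (Finset.mem_univ i))
  have h3 : (F x - F 0) ^ 2 ≤ L ^ 2 * ∑ i, x i ^ 2 := by
    rw [← sq_abs]
    calc |F x - F 0| ^ 2 ≤ (L * ‖x‖) ^ 2 := by gcongr
      _ = L ^ 2 * ‖x‖ ^ 2 := by ring
      _ ≤ _ := by gcongr
  have h0 : 0 ≤ ∑ i, x i ^ 2 := Finset.sum_nonneg fun i _ => sq_nonneg _
  nlinarith [sq_nonneg (F x - 2 * F 0), mul_nonneg (sq_nonneg (F 0)) h0, sq_nonneg (L : ℝ)]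

theorem memLp_two_of_lipschitzWith {d : ℕ} {κ K : ℝ} (hκ : 0 < κ) {u v : Fin d → ℝ → ℝ}
    (h : ∀ i, IsNicePotential κ K (u i) (v i)) {F : (Fin d → ℝ) → ℝ} {L : NNReal}
    (hF : LipschitzWith L F) : MemLp F 2 (Measure.pi fun i => densityMeasure (u i)) := by
  rw [memLp_two_iff_integrable_sq hF.continuous.aestronglyMeasurable]
  refine integrable_pi_of_abs_le hκ h (hF.continuous.pow 2) (C := 2 * F 0 ^ 2 + 2 * L ^ 2) fun x => ?_
  rw [abs_of_nonneg (sq_nonneg _)]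
  exact hF.sq_le_quadratic x

theorem LipschitzWith.integral {Ω E : Type*} [MeasurableSpace Ω] [PseudoMetricSpace E]
    {μ : Measure Ω} [IsProbabilityMeasure μ] {f : Ω → E → ℝ} {L : NNReal}
    (hf : ∀ ω, LipschitzWith L (f ω)) (hi : ∀ y, Integrable (fun ω => f ω y) μ) :
    LipschitzWith L fun y => ∫ ω, f ω y ∂μ := by
  refine LipschitzWith.of_dist_le_mul fun x y => ?_
  rw [Real.dist_eq, ← integral_sub (hi x) (hi y), ← Real.norm_eq_abs]
  have := norm_integral_le_of_norm_le_const (μ := μ) (f := fun ω => f ω x - f ω y)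
    (C := L * dist x y) (Eventually.of_forall fun ω => by
      rw [Real.norm_eq_abs, ← Real.dist_eq]; exact (hf ω).dist_le_mul x y)
  simpa using this

theorem hasDerivAt_integral_of_bounded {Ω : Type*} [MeasurableSpace Ω] {μ : Measure Ω}
    [IsProbabilityMeasure μ] {f f' : ℝ → Ω → ℝ} {C : ℝ} (hi : ∀ s, Integrable (f s) μ)
    (hm : ∀ s, AEStronglyMeasurable (f' s) μ) (hb : ∀ s ω, |f' s ω| ≤ C)
    (hd : ∀ s ω, HasDerivAt (fun s => f s ω) (f' s ω) s) (s : ℝ) :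
    HasDerivAt (fun s => ∫ ω, f s ω ∂μ) (∫ ω, f' s ω ∂μ) s :=
  (hasDerivAt_integral_of_dominated_loc_of_deriv_le (F := f) (F' := f') (bound := fun _ => C)
    univ_mem (Eventually.of_forall fun s => (hi s).1) (hi s) (hm s)
    (Eventually.of_forall fun ω s _ => hb s ω) (integrable_const C)
    (Eventually.of_forall fun ω s _ => hd s ω)).2

theorem lipschitzWith_insertNth_right {d : ℕ} (i : Fin (d + 1)) (t : ℝ) :
    LipschitzWith 1 fun y : Fin d → ℝ => (i.insertNth t y : Fin (d + 1) → ℝ) :=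
  LipschitzWith.of_dist_le_mul fun x y => by
    rw [Fin.dist_insertNth_insertNth]; simp

theorem lipschitzWith_insertNth_left {d : ℕ} (i : Fin (d + 1)) (y : Fin d → ℝ) :
    LipschitzWith 1 fun t : ℝ => (i.insertNth t y : Fin (d + 1) → ℝ) :=
  LipschitzWith.of_dist_le_mul fun s t => by
    rw [Fin.dist_insertNth_insertNth]; simp

theorem LipschitzWith.comp_insertNth_right {d : ℕ} {F : (Fin (d + 1) → ℝ) → ℝ} {L : NNReal}
    (hF : LipschitzWith L F) (i : Fin (d + 1)) (t : ℝ) :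
    LipschitzWith L fun y : Fin d → ℝ => F (i.insertNth t y) := by
  have := hF.comp (lipschitzWith_insertNth_right i t)
  rwa [mul_one] at this

theorem LipschitzWith.comp_insertNth_left {d : ℕ} {F : (Fin (d + 1) → ℝ) → ℝ} {L : NNReal}
    (hF : LipschitzWith L F) (i : Fin (d + 1)) (y : Fin d → ℝ) :
    LipschitzWith L fun t : ℝ => F (i.insertNth t y) := by
  have := hF.comp (lipschitzWith_insertNth_left i y)
  rwa [mul_one] at this

theorem IsNicePotential.memLp_two_of_lipschitzWith {κ K : ℝ} {u v φ : ℝ → ℝ} {L : NNReal}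
    (hκ : 0 < κ) (h : IsNicePotential κ K u v) (hφ : LipschitzWith L φ) :
    MemLp φ 2 (densityMeasure u) := by
  refine h.memLp_of_sq_le hκ hφ.continuous.measurable (C := 2 * φ 0 ^ 2 + 2 * L ^ 2) fun x => ?_
  have h1 := hφ.dist_le_mul x 0
  rw [Real.dist_eq, Real.dist_eq, sub_zero] at h1
  have h3 : (φ x - φ 0) ^ 2 ≤ L ^ 2 * x ^ 2 := by
    rw [← sq_abs, ← sq_abs x]
    calc |φ x - φ 0| ^ 2 ≤ (L * |x|) ^ 2 := by gcongr
      _ = _ := by ring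
  nlinarith [sq_nonneg (φ x - 2 * φ 0), mul_nonneg (sq_nonneg (φ 0)) (sq_nonneg x),
    sq_nonneg (L : ℝ)]

/-- Tensorized Poincaré inequality. -/
theorem poincare_pi {κ K C : ℝ} (hκ : 0 < κ) : ∀ (d : ℕ) {u v : Fin d → ℝ → ℝ}
    (_ : ∀ i, IsNicePotential κ K (u i) (v i)) {F : (Fin d → ℝ) → ℝ}
    {D : Fin d → (Fin d → ℝ) → ℝ} {L : NNReal} (_ : LipschitzWith L F)
    (_ : ∀ j, Continuous (D j)) (_ : ∀ j x, |D j x| ≤ C)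
    (_ : ∀ x j s, HasDerivAt (fun s => F (Function.update x j s)) (D j (Function.update x j s)) s),
    ∫ x, F x ^ 2 ∂(Measure.pi fun i => densityMeasure (u i))
      - (∫ x, F x ∂Measure.pi fun i => densityMeasure (u i)) ^ 2
      ≤ 1 / κ * ∑ j, ∫ x, D j x ^ 2 ∂Measure.pi fun i => densityMeasure (u i)
  | 0, u, v, _, F, D, L, _, _, _, _ => by
    rw [Measure.pi_of_empty, integral_dirac, integral_dirac]
    simp
  | d + 1, u, v, h, F, D, L, hF, hDc, hDb, hd => by
    have hprob : ∀ i, IsProbabilityMeasure (densityMeasure (u i)) :=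
      fun i => (h i).isProbabilityMeasure
    set i₀ : Fin (d + 1) := 0
    set ν := Measure.pi fun i => densityMeasure (u i) with hν
    set ν' := Measure.pi fun j => densityMeasure (u (i₀.succAbove j)) with hν'
    have hsec : ∀ y : Fin d → ℝ, MemLp (fun t => F (i₀.insertNth t y)) 2 (densityMeasure (u i₀)) :=
      fun y => (h i₀).memLp_two_of_lipschitzWith hκ (hF.comp_insertNth_left i₀ y)
    have hseci : ∀ y : Fin d → ℝ, Integrable (fun t => F (i₀.insertNth t y))
      (densityMeasure (u i₀)) := fun y => (hsec y).integrable (by norm_num)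
    have hFL : MemLp F 2 ν := memLp_two_of_lipschitzWith hκ h hF
    have hDsq : ∀ j x, D j x ^ 2 ≤ C ^ 2 := fun j x =>
      sq_le_sq' (by linarith [abs_le.1 (hDb j x)]) (abs_le.1 (hDb j x)).2
    have hDt : ∀ j (y : Fin d → ℝ), Continuous fun t => D j (i₀.insertNth t y) := fun j y =>
      (hDc j).comp ((continuous_insertNth i₀).comp (Continuous.prodMk_right y))
    have hDy : ∀ j (t : ℝ), Continuous fun y : Fin d → ℝ => D j (i₀.insertNth t y) := fun j t =>
      (hDc j).comp ((continuous_insertNth i₀).comp (Continuous.prodMk_left t))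
    have hDsec : ∀ j (y : Fin d → ℝ), MemLp (fun t => D j (i₀.insertNth t y)) 2
        (densityMeasure (u i₀)) := fun j y =>
      MemLp.of_bound (hDt j y).aestronglyMeasurable C (Eventually.of_forall fun t => hDb _ _)
    have hDi : ∀ j, Integrable (fun x => D j x ^ 2) ν := fun j =>
      (integrable_const (C ^ 2)).mono' ((hDc j).pow 2).aestronglyMeasurable
        (Eventually.of_forall fun x => by
          rw [Real.norm_eq_abs, abs_of_nonneg (sq_nonneg _)]; exact hDsq j x)
    have hG : LipschitzWith L fun y => ∫ t, F (i₀.insertNth t y) ∂densityMeasure (u i₀) :=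
      LipschitzWith.integral (f := fun t (y : Fin d → ℝ) => F (i₀.insertNth t y))
        (fun t => hF.comp_insertNth_right i₀ t) hseci
    have hGc : ∀ j, Continuous fun y : Fin d → ℝ =>
        ∫ t, D (i₀.succAbove j) (i₀.insertNth t y) ∂densityMeasure (u i₀) := fun j =>
      continuous_of_dominated (fun y => (hDt _ y).aestronglyMeasurable)
        (fun y => Eventually.of_forall fun t => hDb _ _) (integrable_const C)
        (Eventually.of_forall fun t => hDy _ t)
    have hIH := poincare_pi hκ d (fun j => h (i₀.succAbove j))
      (F := fun y => ∫ t, F (i₀.insertNth t y) ∂densityMeasure (u i₀))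
      (D := fun j y => ∫ t, D (i₀.succAbove j) (i₀.insertNth t y) ∂densityMeasure (u i₀))
      hG hGc
      (fun j y => by
        have := norm_integral_le_of_norm_le_const (μ := densityMeasure (u i₀))
          (f := fun t => D (i₀.succAbove j) (i₀.insertNth t y)) (C := C)
          (Eventually.of_forall fun t => hDb _ _)
        simpa using this)
      (fun y j s => hasDerivAt_integral_of_bounded
        (f := fun s t => F (i₀.insertNth t (Function.update y j s)))
        (f' := fun s t => D (i₀.succAbove j) (i₀.insertNth t (Function.update y j s)))
        (fun s => hseci _) (fun s => (hDt _ _).aestronglyMeasurable) (fun s t => hDb _ _)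
        (fun s t => by
          simp only [Fin.insertNth_update]
          exact hd _ _ _) s)
    have hGi : MemLp (fun y => ∫ t, F (i₀.insertNth t y) ∂densityMeasure (u i₀)) 2 ν' :=
      memLp_two_of_lipschitzWith hκ (fun j => h (i₀.succAbove j)) hG
    have hFi := hFL.integrable (by norm_num : (1 : ℝ≥0∞) ≤ 2)
    have hstep : ∫ x, F x ^ 2 ∂ν ≤ ∫ y, (∫ t, F (i₀.insertNth t y) ∂densityMeasure (u i₀)) ^ 2 ∂ν'
        + 1 / κ * ∫ x, D i₀ x ^ 2 ∂ν := by
      rw [integral_insertNth i₀ hFL.integrable_sq, integral_insertNth i₀ (hDi i₀),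
        ← integral_const_mul, ← integral_add hGi.integrable_sq
          ((integrable_insertNth i₀ (hDi i₀)).integral_prod_left.const_mul _)]
      refine integral_mono (integrable_insertNth i₀ hFL.integrable_sq).integral_prod_left
        (hGi.integrable_sq.add
          ((integrable_insertNth i₀ (hDi i₀)).integral_prod_left.const_mul _)) fun y => ?_
      have := (h i₀).poincare hκ (φ := fun t => F (i₀.insertNth t y))
        (φ' := fun t => D i₀ (i₀.insertNth t y)) (C := C)
        (fun t => by
          have := hd (i₀.insertNth t y) i₀ t
          simpa only [Fin.update_insertNth] using this) (hDt _ y) (fun t => hDb _ _)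
      simp only
      linarith
    have hJ : ∀ j, ∫ y, (∫ t, D (i₀.succAbove j) (i₀.insertNth t y) ∂densityMeasure (u i₀)) ^ 2 ∂ν'
        ≤ ∫ x, D (i₀.succAbove j) x ^ 2 ∂ν := fun j => by
      rw [integral_insertNth i₀ (hDi _)]
      refine integral_mono_of_nonneg (Eventually.of_forall fun y => sq_nonneg _)
        (integrable_insertNth i₀ (hDi _)).integral_prod_left (Eventually.of_forall fun y => ?_)
      exact sq_integral_le (hDsec _ y)
    have hJ' := mul_le_mul_of_nonneg_left (Finset.sum_le_sum fun j (_ : j ∈ Finset.univ) => hJ j)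
      (by positivity : 0 ≤ 1 / κ)
    rw [Fin.sum_univ_succAbove _ i₀, mul_add, integral_insertNth i₀ hFi]
    linarith

theorem lipschitzWith_of_hasDerivAt_bounded {φ φ' : ℝ → ℝ} {C : ℝ}
    (hφ : ∀ x, HasDerivAt φ (φ' x) x) (hC : ∀ x, |φ' x| ≤ C) : LipschitzWith C.toNNReal φ := by
  refine lipschitzWith_of_nnnorm_deriv_le (fun x => (hφ x).differentiableAt) fun x => ?_
  rw [(hφ x).deriv, ← NNReal.coe_le_coe, coe_nnnorm, Real.norm_eq_abs]
  exact (hC x).trans (Real.le_coe_toNNReal C)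

namespace IsNicePotential

variable {κ K : ℝ} {u v u' v' : ℝ → ℝ}

theorem integrable_exp (h : IsNicePotential κ K u v) : Integrable fun x => Real.exp (-u x) := by
  have := h.isProbabilityMeasure
  have := (integrable_densityMeasure_iff (φ := fun _ => (1 : ℝ)) h.continuous.measurable).1
    (integrable_const _)
  simpa using this

theorem integrable_self (h : IsNicePotential κ K u v) (h' : IsNicePotential κ K u' v')
    (hκ : 0 < κ) : Integrable u' (densityMeasure u) := by
  obtain ⟨C, -, hC⟩ := h'.abs_le_quadratic hκ.le
  exact h.integrable hκ h'.continuous.measurable hC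

/-- The squared Hellinger distance is at most the relative entropy. -/
theorem hellinger_le (h : IsNicePotential κ K u v) (h' : IsNicePotential κ K u' v') (hκ : 0 < κ) :
    (Integrable fun x => (Real.exp (-(u x / 2)) - Real.exp (-(u' x / 2))) ^ 2) ∧
    ∫ x, (Real.exp (-(u x / 2)) - Real.exp (-(u' x / 2))) ^ 2 ≤
      ∫ x, (u' x - u x) ∂densityMeasure u := by
  have hprob := h.isProbabilityMeasure
  have hc := h.continuous
  have hc' := h'.continuous
  have he := h.integrable_exp
  have he' := h'.integrable_exp
  have hd : Integrable (fun x => u' x - u x) (densityMeasure u) :=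
    (h.integrable_self h' hκ).sub (h.integrable_self h hκ)
  have hd' := (integrable_densityMeasure_iff hc.measurable).1 hd
  have hsq : ∀ (w : ℝ → ℝ) x, Real.exp (-(w x / 2)) ^ 2 = Real.exp (-w x) := fun w x => by
    rw [← Real.exp_nat_mul]; congr 1; push_cast; ring
  have hle : ∀ x, (Real.exp (-(u x / 2)) - Real.exp (-(u' x / 2))) ^ 2 ≤
      (u' x - u x) * Real.exp (-u x) + (Real.exp (-u' x) - Real.exp (-u x)) := fun x => by
    have h1 : Real.exp (-(u x / 2)) * Real.exp (-(u' x / 2))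
        = Real.exp (-u x) * Real.exp (-((u' x - u x) / 2)) := by
      rw [← Real.exp_add, ← Real.exp_add]; congr 1; ring
    have h2 := Real.add_one_le_exp (-((u' x - u x) / 2))
    have h3 := mul_le_mul_of_nonneg_left h2 (Real.exp_pos (-u x)).le
    have h4 : (Real.exp (-(u x / 2)) - Real.exp (-(u' x / 2))) ^ 2 = Real.exp (-u x)
        + Real.exp (-u' x) - 2 * (Real.exp (-u x) * Real.exp (-((u' x - u x) / 2))) := by
      rw [← h1, ← hsq u, ← hsq u']; ring
    rw [h4]; nlinarith
  have hR := hd'.add (he'.sub he)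
  have hInt : Integrable fun x => (Real.exp (-(u x / 2)) - Real.exp (-(u' x / 2))) ^ 2 :=
    hR.mono' (by fun_prop) (Eventually.of_forall fun x => by
      rw [Real.norm_eq_abs, abs_of_nonneg (sq_nonneg _)]; exact hle x)
  refine ⟨hInt, (integral_mono hInt hR hle).trans ?_⟩
  simp only [Pi.add_apply, Pi.sub_apply]
  rw [integral_add hd' (by exact he'.sub he), integral_sub he' he, h.integral_exp, h'.integral_exp,
    integral_densityMeasure hc.measurable (φ := fun x => u' x - u x)]
  simp

/-- Stability of expectations under perturbations small in relative entropy. -/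
theorem sq_integral_sub_le (h : IsNicePotential κ K u v) (h' : IsNicePotential κ K u' v')
    (hκ : 0 < κ) {φ φ' : ℝ → ℝ} {C η : ℝ} (hφ : ∀ x, HasDerivAt φ (φ' x) x) (hc : Continuous φ')
    (hC : ∀ x, |φ' x| ≤ C) (hη : ∫ x, (u' x - u x) ∂densityMeasure u ≤ η) (hη' : η ≤ 1 / 4) :
    (∫ x, φ x ∂densityMeasure u - ∫ x, φ x ∂densityMeasure u') ^ 2 ≤ 8 * η * (C ^ 2 / κ) := by
  have hprob := h.isProbabilityMeasure
  have hprob' := h'.isProbabilityMeasure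
  have hum := h.continuous.measurable
  have hum' := h'.continuous.measurable
  have huc := h.continuous
  have huc' := h'.continuous
  have hL := lipschitzWith_of_hasDerivAt_bounded hφ hC
  have hφc := hL.continuous
  have hφ2 := h.memLp_two_of_lipschitzWith hκ hL
  have hφ2' := h'.memLp_two_of_lipschitzWith hκ hL
  obtain ⟨hHi, hH⟩ := h.hellinger_le h' hκ
  have hH0 : 0 ≤ η := (integral_nonneg fun x => sq_nonneg _).trans (hH.trans hη)
  have hV : ∀ {u v}, IsNicePotential κ K u v → ∫ x, φ x ^ 2 ∂densityMeasure u
      - (∫ x, φ x ∂densityMeasure u) ^ 2 ≤ C ^ 2 / κ := fun {u v} h => by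
    have hprob := h.isProbabilityMeasure
    refine (h.poincare hκ hφ hc hC).trans ?_
    rw [one_div, ← div_eq_inv_mul]
    refine div_le_div_of_nonneg_right ?_ hκ.le
    have hb : ∀ x, φ' x ^ 2 ≤ C ^ 2 := fun x =>
      sq_le_sq' (by linarith [abs_le.1 (hC x)]) (abs_le.1 (hC x)).2
    have : ∫ x, φ' x ^ 2 ∂densityMeasure u ≤ ∫ x, C ^ 2 ∂densityMeasure u :=
      integral_mono_of_nonneg (Eventually.of_forall fun x => sq_nonneg _) (integrable_const _)
        (Eventually.of_forall hb)
    simpa using this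
  have hV1 := hV h
  have hV2 := hV h'
  set c := ∫ x, φ x ∂densityMeasure u with hcdef
  set c' := ∫ x, φ x ∂densityMeasure u' with hc'def
  have hcent : ∀ {u v}, IsNicePotential κ K u v → MemLp φ 2 (densityMeasure u) →
      Integrable (fun x => (φ x - c) ^ 2) (densityMeasure u) ∧
      ∫ x, (φ x - c) ^ 2 ∂densityMeasure u = ∫ x, φ x ^ 2 ∂densityMeasure u
        - 2 * c * (∫ x, φ x ∂densityMeasure u) + c ^ 2 := fun {u v} h hφ2 => by
    have hprob := h.isProbabilityMeasure
    have : (fun x => (φ x - c) ^ 2) = fun x => φ x ^ 2 - 2 * c * φ x + c ^ 2 := by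
      ext x; ring
    have hi := hφ2.integrable (by norm_num : (1 : ℝ≥0∞) ≤ 2)
    have hi1 : Integrable (fun x => φ x ^ 2 - 2 * c * φ x) (densityMeasure u) :=
      hφ2.integrable_sq.sub (hi.const_mul _)
    refine ⟨this ▸ hi1.add (integrable_const _), ?_⟩
    rw [this, integral_add hi1 (integrable_const _),
      integral_sub hφ2.integrable_sq (hi.const_mul _), integral_const_mul]
    simp
  obtain ⟨hi1, he1⟩ := hcent h hφ2
  obtain ⟨hi2, he2⟩ := hcent h' hφ2'
  have hsq : ∀ (w : ℝ → ℝ) x, Real.exp (-(w x / 2)) ^ 2 = Real.exp (-w x) := fun w x => by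
    rw [← Real.exp_nat_mul]; congr 1; push_cast; ring
  have hφi := hφ2.integrable (by norm_num : (1 : ℝ≥0∞) ≤ 2)
  have hφi' := hφ2'.integrable (by norm_num : (1 : ℝ≥0∞) ≤ 2)
  have hi1' := (integrable_densityMeasure_iff hum).1 hi1
  have hi2' := (integrable_densityMeasure_iff hum').1 hi2
  have hg1 := (integrable_densityMeasure_iff hum).1 (hφi.sub (integrable_const c))
  have hg2 := (integrable_densityMeasure_iff hum').1 (hφi'.sub (integrable_const c))
  have hkey : ∀ l : ℝ, 2 * l * (c - c') ≤ η + 2 * l ^ 2 * (2 * (C ^ 2 / κ) + (c - c') ^ 2) := by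
    intro l
    have hpt : ∀ x, 2 * l * ((φ x - c) * Real.exp (-u x) - (φ x - c) * Real.exp (-u' x)) ≤
        (Real.exp (-(u x / 2)) - Real.exp (-(u' x / 2))) ^ 2
        + 2 * l ^ 2 * ((φ x - c) ^ 2 * Real.exp (-u x) + (φ x - c) ^ 2 * Real.exp (-u' x)) := by
      intro x
      rw [← hsq u, ← hsq u']
      set a := Real.exp (-(u x / 2))
      set b := Real.exp (-(u' x / 2))
      nlinarith [sq_nonneg ((a - b) - l * (φ x - c) * (a + b)), sq_nonneg (l * (φ x - c) * (a - b))]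
    have := integral_mono ((hg1.sub hg2).const_mul (2 * l))
      (hHi.add ((hi1'.add hi2').const_mul (2 * l ^ 2))) hpt
    simp only [Pi.add_apply, Pi.sub_apply] at this
    rw [integral_const_mul, integral_sub (by exact hg1) (by exact hg2),
      integral_add hHi (by exact (hi1'.add hi2').const_mul (2 * l ^ 2)),
      integral_const_mul, integral_add hi1' hi2',
      ← integral_densityMeasure hum (φ := fun x => φ x - c),
      ← integral_densityMeasure hum' (φ := fun x => φ x - c),
      ← integral_densityMeasure hum (φ := fun x => (φ x - c) ^ 2),
      ← integral_densityMeasure hum' (φ := fun x => (φ x - c) ^ 2), he1, he2,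
      integral_sub hφi (integrable_const _), integral_sub hφi' (integrable_const _)] at this
    simp only [integral_const, probReal_univ, one_smul, ← hcdef, ← hc'def] at this
    have h5 : 2 * l ^ 2 * ((∫ x, φ x ^ 2 ∂densityMeasure u) - 2 * c * c + c ^ 2
        + ((∫ x, φ x ^ 2 ∂densityMeasure u') - 2 * c * c' + c ^ 2))
        ≤ 2 * l ^ 2 * (2 * (C ^ 2 / κ) + (c - c') ^ 2) :=
      mul_le_mul_of_nonneg_left (by nlinarith) (by positivity)
    linarith [hH.trans hη]
  have hS0 : 0 ≤ C ^ 2 / κ := by positivity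
  rcases eq_or_ne (c - c') 0 with h0 | h0
  · rw [h0]; simp only [ne_eq, OfNat.ofNat_ne_zero, not_false_eq_true, zero_pow]; positivity
  · have hpos : 0 < (c - c') ^ 2 := by positivity
    have h1 := hkey ((c - c') / (2 * (2 * (C ^ 2 / κ) + (c - c') ^ 2)))
    set S := 2 * (C ^ 2 / κ) + (c - c') ^ 2 with hS
    have hSpos : 0 < S := by positivity
    have h2 : (c - c') ^ 2 ≤ 2 * η * S := by
      have e1 : 2 * ((c - c') / (2 * S)) * (c - c') = (c - c') ^ 2 / S := by field_simp
      have e2 : 2 * ((c - c') / (2 * S)) ^ 2 * S = (c - c') ^ 2 / S / 2 := by field_simp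
      rw [e1, e2] at h1
      have : (c - c') ^ 2 / S ≤ 2 * η := by linarith
      rwa [div_le_iff₀ hSpos] at this
    nlinarith

end IsNicePotential

/-- Stability of expectations of smooth Lipschitz functions under products. -/
theorem abs_integral_pi_sub_le {κ K C η : ℝ} (hκ : 0 < κ) (hη' : η ≤ 1 / 4) :
    ∀ (d : ℕ) {u v u' v' : Fin d → ℝ → ℝ}
    (_ : ∀ i, IsNicePotential κ K (u i) (v i)) (_ : ∀ i, IsNicePotential κ K (u' i) (v' i))
    (_ : ∀ i, ∫ x, (u' i x - u i x) ∂densityMeasure (u i) ≤ η) {F : (Fin d → ℝ) → ℝ}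
    {D : Fin d → (Fin d → ℝ) → ℝ} {L : NNReal} (_ : LipschitzWith L F)
    (_ : ∀ j, Continuous (D j)) (_ : ∀ j x, |D j x| ≤ C)
    (_ : ∀ x j s, HasDerivAt (fun s => F (Function.update x j s)) (D j (Function.update x j s)) s),
    |∫ x, F x ∂(Measure.pi fun i => densityMeasure (u i))
      - ∫ x, F x ∂Measure.pi fun i => densityMeasure (u' i)|
      ≤ d * √(8 * η * (C ^ 2 / κ))
  | 0, u, v, u', v', _, _, _, F, D, L, _, _, _, _ => by
    rw [Measure.pi_of_empty, Measure.pi_of_empty, integral_dirac]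
    simp
  | d + 1, u, v, u', v', h, h', hη, F, D, L, hF, hDc, hDb, hd => by
    have hprob : ∀ i, IsProbabilityMeasure (densityMeasure (u i)) :=
      fun i => (h i).isProbabilityMeasure
    have hprob' : ∀ i, IsProbabilityMeasure (densityMeasure (u' i)) :=
      fun i => (h' i).isProbabilityMeasure
    set i₀ : Fin (d + 1) := 0
    have hL1 : ∀ {w z : ℝ → ℝ}, IsNicePotential κ K w z → ∀ y : Fin d → ℝ,
        Integrable (fun t => F (i₀.insertNth t y)) (densityMeasure w) := fun {w z} hw y => by
      have := hw.isProbabilityMeasure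
      exact (hw.memLp_two_of_lipschitzWith hκ (hF.comp_insertNth_left i₀ y)).integrable
        (by norm_num)
    have hDt : ∀ j (y : Fin d → ℝ), Continuous fun t => D j (i₀.insertNth t y) := fun j y =>
      (hDc j).comp ((continuous_insertNth i₀).comp (Continuous.prodMk_right y))
    have hDy : ∀ j (t : ℝ), Continuous fun y : Fin d → ℝ => D j (i₀.insertNth t y) := fun j t =>
      (hDc j).comp ((continuous_insertNth i₀).comp (Continuous.prodMk_left t))
    have hG : ∀ {w z : ℝ → ℝ}, IsNicePotential κ K w z →
        LipschitzWith L fun y => ∫ t, F (i₀.insertNth t y) ∂densityMeasure w := fun {w z} hw => by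
      have := hw.isProbabilityMeasure
      exact LipschitzWith.integral (f := fun t (y : Fin d → ℝ) => F (i₀.insertNth t y))
        (fun t => hF.comp_insertNth_right i₀ t) (hL1 hw)
    have hIH := abs_integral_pi_sub_le hκ hη' d (fun j => h (i₀.succAbove j))
      (fun j => h' (i₀.succAbove j)) (fun j => hη (i₀.succAbove j))
      (F := fun y => ∫ t, F (i₀.insertNth t y) ∂densityMeasure (u i₀))
      (D := fun j y => ∫ t, D (i₀.succAbove j) (i₀.insertNth t y) ∂densityMeasure (u i₀))
      (C := C) (hG (h i₀))
      (fun j => continuous_of_dominated (fun y => (hDt _ y).aestronglyMeasurable)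
        (fun y => Eventually.of_forall fun t => hDb _ _) (integrable_const C)
        (Eventually.of_forall fun t => hDy _ t))
      (fun j y => by
        have := norm_integral_le_of_norm_le_const (μ := densityMeasure (u i₀))
          (f := fun t => D (i₀.succAbove j) (i₀.insertNth t y)) (C := C)
          (Eventually.of_forall fun t => hDb _ _)
        simpa using this)
      (fun y j s => hasDerivAt_integral_of_bounded
        (f := fun s t => F (i₀.insertNth t (Function.update y j s)))
        (f' := fun s t => D (i₀.succAbove j) (i₀.insertNth t (Function.update y j s)))
        (fun s => hL1 (h i₀) _) (fun s => (hDt _ _).aestronglyMeasurable) (fun s t => hDb _ _)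
        (fun s t => by
          simp only [Fin.insertNth_update]
          exact hd _ _ _) s)
    have hFi := (memLp_two_of_lipschitzWith hκ h hF).integrable (by norm_num : (1 : ℝ≥0∞) ≤ 2)
    have hFi' := (memLp_two_of_lipschitzWith hκ h' hF).integrable (by norm_num : (1 : ℝ≥0∞) ≤ 2)
    have hGi : ∀ {w z : ℝ → ℝ}, IsNicePotential κ K w z →
        Integrable (fun y => ∫ t, F (i₀.insertNth t y) ∂densityMeasure w)
          (Measure.pi fun j => densityMeasure (u' (i₀.succAbove j))) := fun {w z} hw =>
      (memLp_two_of_lipschitzWith hκ (fun j => h' (i₀.succAbove j)) (hG hw)).integrable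
        (by norm_num)
    have h1 : |∫ y, ∫ t, F (i₀.insertNth t y) ∂densityMeasure (u i₀)
          ∂(Measure.pi fun j => densityMeasure (u' (i₀.succAbove j)))
        - ∫ y, ∫ t, F (i₀.insertNth t y) ∂densityMeasure (u' i₀)
          ∂(Measure.pi fun j => densityMeasure (u' (i₀.succAbove j)))|
        ≤ √(8 * η * (C ^ 2 / κ)) := by
      rw [← integral_sub (hGi (h i₀)) (hGi (h' i₀))]
      have := norm_integral_le_of_norm_le_const
        (μ := Measure.pi fun j => densityMeasure (u' (i₀.succAbove j)))
        (f := fun y => ∫ t, F (i₀.insertNth t y) ∂densityMeasure (u i₀)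
          - ∫ t, F (i₀.insertNth t y) ∂densityMeasure (u' i₀)) (C := √(8 * η * (C ^ 2 / κ)))
        (Eventually.of_forall fun y => by
          refine Real.abs_le_sqrt ((h i₀).sq_integral_sub_le (h' i₀) hκ
            (φ' := fun t => D i₀ (i₀.insertNth t y)) (fun t => ?_) (hDt _ y) (fun t => hDb _ _)
            (hη i₀) hη')
          have := hd (i₀.insertNth t y) i₀ t
          simpa only [Fin.update_insertNth] using this)
      simpa using this
    rw [integral_insertNth i₀ hFi, integral_insertNth i₀ hFi']
    push_cast
    calc _ ≤ _ := abs_sub_le _ (∫ y, ∫ t, F (i₀.insertNth t y) ∂densityMeasure (u i₀)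
          ∂(Measure.pi fun j => densityMeasure (u' (i₀.succAbove j)))) _
      _ ≤ _ := add_le_add hIH h1
      _ = _ := by ring

theorem pi_densityMeasure {d : ℕ} {u : Fin d → ℝ → ℝ}
    (hi : ∀ i, Integrable fun x => Real.exp (-u i x)) [∀ i, SigmaFinite (densityMeasure (u i))] :
    (Measure.pi fun i => densityMeasure (u i)) =
      volume.withDensity fun x => ENNReal.ofReal (Real.exp (-∑ i, u i (x i))) := by
  refine Measure.pi_eq fun s hs => ?_
  rw [withDensity_apply _ (MeasurableSet.univ_pi hs), volume_pi, Measure.restrict_pi_pi]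
  have hprod : ∀ x : Fin d → ℝ, Real.exp (-∑ i, u i (x i)) = ∏ i, Real.exp (-u i (x i)) := by
    intro x; rw [← Real.exp_sum, Finset.sum_neg_distrib]
  simp only [hprod]
  rw [← ofReal_integral_eq_lintegral_ofReal
    (Integrable.fintype_prod (f := fun i t => Real.exp (-u i t)) fun i => (hi i).restrict)
    (Eventually.of_forall fun x => Finset.prod_nonneg fun i _ => (Real.exp_pos _).le),
    integral_fintype_prod_eq_prod (fun i t => Real.exp (-u i t)),
    ENNReal.ofReal_prod_of_nonneg fun i _ => integral_nonneg fun t => (Real.exp_pos _).le]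
  refine Finset.prod_congr rfl fun i _ => ?_
  rw [densityMeasure, withDensity_apply _ (hs i),
    ofReal_integral_eq_lintegral_ofReal (hi i).restrict
      (Eventually.of_forall fun x => (Real.exp_pos _).le)]

theorem isNicePotential_normalize {κ K : ℝ} (hκ : 0 < κ) {f f' : ℝ → ℝ}
    (hf : ∀ x, HasDerivAt f (f' x) x) (hl : ∀ x y, x ≤ y → κ * (y - x) ≤ f' y - f' x)
    (hu : ∀ x y, x ≤ y → f' y - f' x ≤ K * (y - x)) :
    IsNicePotential κ K (fun x => f x + Real.log (∫ t, Real.exp (-f t))) f' := by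
  have hfc : Continuous f := continuous_iff_continuousAt.2 fun x => (hf x).continuousAt
  have hi : Integrable fun t => Real.exp (-f t) := by
    have := integrable_mul_exp_neg_of_quadratic (φ := fun _ => 1) (C := 1) (c₀ := f 0)
      (c₁ := f' 0) hκ hfc.measurable
      (fun x => by simpa using quadratic_lower_bound hf hl 0 x) (by fun_prop)
      (fun x => by simp; positivity)
    simpa using this
  refine ⟨fun x => (hf x).add_const _, hl, hu, ?_⟩
  have hZ := integral_exp_pos hi
  have : ∀ x, Real.exp (-(f x + Real.log (∫ t, Real.exp (-f t))))
      = Real.exp (-f x) * (∫ t, Real.exp (-f t))⁻¹ := fun x => by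
    rw [neg_add, Real.exp_add, Real.exp_neg (Real.log _), Real.exp_log hZ]
  simp only [this]
  rw [integral_mul_const, mul_inv_cancel₀ (ne_of_gt hZ)]

/-- A smooth, strongly convex potential on `ℝ^d` with Lipschitz gradient `p` and Hessian `A`. -/
structure IsNiceInteraction {d : ℕ} (κ C : ℝ) (L : NNReal) (W : (Fin d → ℝ) → ℝ)
    (p : Fin d → (Fin d → ℝ) → ℝ) (A : Fin d → Fin d → (Fin d → ℝ) → ℝ) : Prop where
  continuous : Continuous W
  lower : ∀ x y, W x + ∑ i, p i x * (y i - x i) + κ / 2 * ∑ i, (y i - x i) ^ 2 ≤ W y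
  hasDerivAt : ∀ x i s, HasDerivAt (fun s => W (Function.update x i s))
    (p i (Function.update x i s)) s
  lipschitz : ∀ i, LipschitzWith L (p i)
  hasDerivAt_deriv : ∀ x i j s, HasDerivAt (fun s => p i (Function.update x j s))
    (A i j (Function.update x j s)) s
  continuous_hess : ∀ i j, Continuous (A i j)
  hess_le : ∀ i j x, |A i j x| ≤ C

namespace IsNiceInteraction

variable {d : ℕ} {κ C : ℝ} {L : NNReal}

theorem integrable_exp {W : (Fin d → ℝ) → ℝ} {p : Fin d → (Fin d → ℝ) → ℝ}
    {A : Fin d → Fin d → (Fin d → ℝ) → ℝ} (hW : IsNiceInteraction κ C L W p A) (hκ : 0 < κ) :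
    Integrable fun x => Real.exp (-W x) :=
  integrable_exp_neg_of_paraboloid hκ hW.continuous.measurable (hW.lower 0)

theorem abs_le_quadratic' {W : (Fin d → ℝ) → ℝ} {p : Fin d → (Fin d → ℝ) → ℝ}
    {A : Fin d → Fin d → (Fin d → ℝ) → ℝ} (hW : IsNiceInteraction κ C L W p A) (hκ : 0 < κ) :
    ∃ c, ∀ x, |W x| ≤ c * (1 + ∑ i, x i ^ 2) := by
  have hp := fun i x => (hW.lipschitz i).sq_le_quadratic x
  refine ⟨|W 0| + ∑ i, p i 0 ^ 2 + d + ∑ i, (2 * p i 0 ^ 2 + 2 * L ^ 2) + 1, fun x => ?_⟩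
  have h1 := hW.lower 0 x
  have h2 := hW.lower x 0
  set S := ∑ i, x i ^ 2 with hS
  have hS0 : 0 ≤ S := Finset.sum_nonneg fun i _ => sq_nonneg _
  simp only [Pi.zero_apply, sub_zero, zero_sub, even_two, Even.neg_pow, mul_neg,
    Finset.sum_neg_distrib] at h1 h2
  have h3 : |∑ i, p i 0 * x i| ≤ ∑ i, p i 0 ^ 2 + S := by
    rw [hS, ← Finset.sum_add_distrib]
    refine (Finset.abs_sum_le_sum_abs _ _).trans (Finset.sum_le_sum fun i _ => abs_le.2 ⟨?_, ?_⟩)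
    · nlinarith [sq_nonneg (p i 0 + x i), sq_nonneg (p i 0), sq_nonneg (x i)]
    · nlinarith [sq_nonneg (p i 0 - x i), sq_nonneg (p i 0), sq_nonneg (x i)]
  have h4 : |∑ i, p i x * x i| ≤ (∑ i, (2 * p i 0 ^ 2 + 2 * L ^ 2)) * (1 + S) + S := by
    rw [Finset.sum_mul]
    calc _ ≤ ∑ i, (p i x ^ 2 + x i ^ 2) := by
          refine (Finset.abs_sum_le_sum_abs _ _).trans
            (Finset.sum_le_sum fun i _ => abs_le.2 ⟨?_, ?_⟩)
          · nlinarith [sq_nonneg (p i x + x i), sq_nonneg (p i x), sq_nonneg (x i)]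
          · nlinarith [sq_nonneg (p i x - x i), sq_nonneg (p i x), sq_nonneg (x i)]
      _ ≤ _ := by
          rw [Finset.sum_add_distrib]
          exact add_le_add (Finset.sum_le_sum fun i _ => hp i x) le_rfl
  have h5 : 0 ≤ κ / 2 * S := by positivity
  have h6 : 0 ≤ ∑ i, p i 0 ^ 2 := Finset.sum_nonneg fun i _ => sq_nonneg _
  have h7 : 0 ≤ ∑ i, (2 * p i 0 ^ 2 + 2 * (L : ℝ) ^ 2) := Finset.sum_nonneg fun i _ => by positivity
  have h8 := mul_nonneg h6 hS0
  have h9 := mul_nonneg (abs_nonneg (W 0)) hS0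
  have h10 := mul_nonneg (Nat.cast_nonneg (α := ℝ) d) hS0
  have h11 := mul_nonneg h7 hS0
  have h12 : (0 : ℝ) ≤ d := Nat.cast_nonneg d
  have h13 := abs_le.1 h3
  have h14 := abs_le.1 h4
  have h15 := abs_le.1 (le_refl |W 0|)
  refine abs_le.2 ⟨?_, ?_⟩ <;> nlinarith

section Product

variable {K : ℝ} {W : (Fin d → ℝ) → ℝ} {p : Fin d → (Fin d → ℝ) → ℝ}
  {A : Fin d → Fin d → (Fin d → ℝ) → ℝ} {u v : Fin d → ℝ → ℝ}

theorem integrable (hW : IsNiceInteraction κ C L W p A) (hκ : 0 < κ)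
    (h : ∀ i, IsNicePotential κ K (u i) (v i)) :
    Integrable W (Measure.pi fun i => densityMeasure (u i)) := by
  obtain ⟨c, hc⟩ := hW.abs_le_quadratic' hκ
  exact integrable_pi_of_abs_le hκ h hW.continuous hc

theorem memLp_deriv (hW : IsNiceInteraction κ C L W p A) (hκ : 0 < κ)
    (h : ∀ i, IsNicePotential κ K (u i) (v i)) (i : Fin d) :
    MemLp (p i) 2 (Measure.pi fun i => densityMeasure (u i)) :=
  memLp_two_of_lipschitzWith hκ h (hW.lipschitz i)

/-- Gibbs variational principle: the product free energy dominates `-log Z`. -/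
theorem neg_log_le (hW : IsNiceInteraction κ C L W p A) (hκ : 0 < κ)
    (h : ∀ i, IsNicePotential κ K (u i) (v i)) :
    -Real.log (∫ x, Real.exp (-W x)) ≤ ∫ x, W x ∂(Measure.pi fun i => densityMeasure (u i))
      - ∑ i, ∫ t, u i t ∂densityMeasure (u i) := by
  have hprob : ∀ i, IsProbabilityMeasure (densityMeasure (u i)) :=
    fun i => (h i).isProbabilityMeasure
  have hui : ∀ i, Integrable (u i) (densityMeasure (u i)) := fun i => (h i).integrable_self (h i) hκ
  have hUi : ∀ i, Integrable (fun x : Fin d → ℝ => u i (x i))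
      (Measure.pi fun i => densityMeasure (u i)) := fun i =>
    integrable_comp_eval (μ := fun i => densityMeasure (u i)) (hui i)
  have hZi := hW.integrable_exp hκ
  have hZ := integral_exp_pos hZi
  have hUm : Measurable fun x : Fin d → ℝ => Real.exp (-∑ i, u i (x i)) := by
    have : ∀ i, Measurable (u i) := fun i => (h i).continuous.measurable
    fun_prop
  have hpi := pi_densityMeasure fun i => (h i).integrable_exp
  have htr : ∀ x : Fin d → ℝ, Real.exp (-∑ i, u i (x i)) • Real.exp (∑ i, u i (x i) - W x)
      = Real.exp (-W x) := fun x => by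
    rw [smul_eq_mul, ← Real.exp_add]; congr 1; ring
  have hInt : Integrable (fun x => Real.exp (∑ i, u i (x i) - W x))
      (Measure.pi fun i => densityMeasure (u i)) := by
    rw [hpi, integrable_withDensity_iff_integrable_smul' (by fun_prop) (by simp)]
    simp only [ENNReal.toReal_ofReal (Real.exp_pos _).le, htr]
    exact hZi
  have heq : ∫ x, Real.exp (∑ i, u i (x i) - W x) ∂(Measure.pi fun i => densityMeasure (u i))
      = ∫ x, Real.exp (-W x) := by
    rw [hpi, integral_withDensity_eq_integral_toReal_smul (by fun_prop) (by simp)]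
    simp only [ENNReal.toReal_ofReal (Real.exp_pos _).le, htr]
  set Z := ∫ x, Real.exp (-W x)
  have hlin : Integrable (fun x => ∑ i, u i (x i) - W x - Real.log Z)
      (Measure.pi fun i => densityMeasure (u i)) :=
    ((integrable_finsetSum _ fun i _ => hUi i).sub (hW.integrable hκ h)).sub (integrable_const _)
  have := integral_mono (hlin.add (integrable_const 1)) (hInt.mul_const Z⁻¹) fun x => by
    have h1 := Real.add_one_le_exp (∑ i, u i (x i) - W x - Real.log Z)
    rw [Real.exp_sub _ (Real.log Z), Real.exp_log hZ, div_eq_mul_inv] at h1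
    exact h1
  simp only [Pi.add_apply] at this
  rw [integral_mul_const, heq, mul_inv_cancel₀ hZ.ne', integral_add hlin (integrable_const _),
    integral_sub (by exact (integrable_finsetSum _ fun i _ => hUi i).sub (hW.integrable hκ h))
      (integrable_const _), integral_sub (integrable_finsetSum _ fun i _ => hUi i)
      (hW.integrable hκ h), integral_finsetSum _ fun i _ => hUi i] at this
  simp only [integral_const, probReal_univ, one_smul] at this
  have h2 : ∀ i, ∫ x : Fin d → ℝ, u i (x i) ∂(Measure.pi fun i => densityMeasure (u i))
      = ∫ t, u i t ∂densityMeasure (u i) := fun i =>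
    integral_comp_eval (μ := fun i => densityMeasure (u i)) (hui i).1
  simp only [h2] at this
  linarith

end Product

end IsNiceInteraction

/-- The conditional average of `F` under the product of the densities `exp (-u j)`, `j ≠ i`, with
the `i`-th coordinate fixed. -/
noncomputable def sectionIntegral {d : ℕ} (u : Fin (d + 1) → ℝ → ℝ) (F : (Fin (d + 1) → ℝ) → ℝ)
    (i : Fin (d + 1)) (t : ℝ) : ℝ :=
  ∫ y, F (i.insertNth t y) ∂Measure.pi fun j => densityMeasure (u (i.succAbove j))

/-- The coordinate-ascent update of the `i`-th log-density. -/
noncomputable def coordinateUpdate {d : ℕ} (u : Fin (d + 1) → ℝ → ℝ) (W : (Fin (d + 1) → ℝ) → ℝ)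
    (i : Fin (d + 1)) (t : ℝ) : ℝ :=
  sectionIntegral u W i t + Real.log (∫ s, Real.exp (-sectionIntegral u W i s))

/-- The mean-field free energy of the product of the densities `exp (-u i)`. -/
noncomputable def meanFieldEnergy {d : ℕ} (W : (Fin d → ℝ) → ℝ) (u : Fin d → ℝ → ℝ) : ℝ :=
  ∫ x, W x ∂(Measure.pi fun i => densityMeasure (u i)) - ∑ i, ∫ t, u i t ∂densityMeasure (u i)

namespace IsNiceInteraction

variable {d : ℕ} {κ C K : ℝ} {L : NNReal} {W : (Fin (d + 1) → ℝ) → ℝ}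
  {p : Fin (d + 1) → (Fin (d + 1) → ℝ) → ℝ}
  {A : Fin (d + 1) → Fin (d + 1) → (Fin (d + 1) → ℝ) → ℝ} {u v : Fin (d + 1) → ℝ → ℝ}

theorem hasDerivAt_insertNth (hW : IsNiceInteraction κ C L W p A) (i : Fin (d + 1))
    (y : Fin d → ℝ) (t : ℝ) :
    HasDerivAt (fun t => W (i.insertNth t y)) (p i (i.insertNth t y)) t := by
  simpa using hW.hasDerivAt (i.insertNth t y) i t

theorem mul_sub_le (hW : IsNiceInteraction κ C L W p A) (i : Fin (d + 1)) (y : Fin d → ℝ)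
    {s t : ℝ} (hst : s ≤ t) :
    κ * (t - s) ≤ p i (i.insertNth t y) - p i (i.insertNth s y) := by
  have h1 := hW.lower (i.insertNth s y) (i.insertNth t y)
  have h2 := hW.lower (i.insertNth t y) (i.insertNth s y)
  simp only [Fin.sum_univ_succAbove _ i, Fin.insertNth_apply_same, Fin.insertNth_apply_succAbove,
    sub_self, mul_zero, Finset.sum_const_zero, add_zero, ne_eq, OfNat.ofNat_ne_zero,
    not_false_eq_true, zero_pow] at h1 h2
  rcases hst.eq_or_lt with rfl | hlt
  · simp
  · nlinarith

theorem sub_le_mul (hW : IsNiceInteraction κ C L W p A) (i : Fin (d + 1)) (y : Fin d → ℝ)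
    {s t : ℝ} (hst : s ≤ t) :
    p i (i.insertNth t y) - p i (i.insertNth s y) ≤ L * (t - s) := by
  have := ((hW.lipschitz i).comp_insertNth_left i y).dist_le_mul t s
  rw [Real.dist_eq, Real.dist_eq, abs_of_nonneg (sub_nonneg.2 hst)] at this
  exact (le_abs_self _).trans this

theorem integrable_insertNth (hW : IsNiceInteraction κ C L W p A) (hκ : 0 < κ)
    (h : ∀ i, IsNicePotential κ K (u i) (v i)) (i : Fin (d + 1)) (t : ℝ) :
    Integrable (fun y => W (i.insertNth t y))
      (Measure.pi fun j => densityMeasure (u (i.succAbove j))) := by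
  obtain ⟨c, hc⟩ := hW.abs_le_quadratic' hκ
  have hc0 : 0 ≤ c := by simpa using (abs_nonneg _).trans (hc 0)
  refine integrable_pi_of_abs_le hκ (fun j => h (i.succAbove j))
    (hW.continuous.comp ((continuous_insertNth i).comp (by fun_prop :
      Continuous fun y : Fin d → ℝ => (y, t)))) (C := c * (1 + t ^ 2)) fun y => ?_
  refine (hc _).trans ?_
  simp only [Fin.sum_univ_succAbove _ i, Fin.insertNth_apply_same, Fin.insertNth_apply_succAbove]
  have : 0 ≤ ∑ j, y j ^ 2 := Finset.sum_nonneg fun j _ => sq_nonneg _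
  rw [mul_assoc]
  refine mul_le_mul_of_nonneg_left ?_ hc0
  nlinarith [mul_nonneg (sq_nonneg t) this]

theorem memLp_deriv_insertNth (hW : IsNiceInteraction κ C L W p A) (hκ : 0 < κ)
    (h : ∀ i, IsNicePotential κ K (u i) (v i)) (i : Fin (d + 1)) (t : ℝ) :
    MemLp (fun y => p i (i.insertNth t y)) 2
      (Measure.pi fun j => densityMeasure (u (i.succAbove j))) :=
  memLp_two_of_lipschitzWith hκ (fun j => h (i.succAbove j))
    ((hW.lipschitz i).comp_insertNth_right i t)

theorem hasDerivAt_sectionIntegral (hW : IsNiceInteraction κ C L W p A) (hκ : 0 < κ)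
    (h : ∀ i, IsNicePotential κ K (u i) (v i)) (i : Fin (d + 1)) (t : ℝ) :
    HasDerivAt (sectionIntegral u W i) (sectionIntegral u (p i) i t) t := by
  have := fun j => (h j).isProbabilityMeasure
  have hp : ∀ t, Integrable (fun y => p i (i.insertNth t y))
      (Measure.pi fun j => densityMeasure (u (i.succAbove j))) := fun t =>
    (hW.memLp_deriv_insertNth hκ h i t).integrable one_le_two
  refine (hasDerivAt_integral_of_dominated_loc_of_deriv_le (Metric.ball_mem_nhds t one_pos)
    (bound := fun y => |p i (i.insertNth t y)| + L)
    (.of_forall fun s => (hW.integrable_insertNth hκ h i s).aestronglyMeasurable)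
    (hW.integrable_insertNth hκ h i t) (hp t).aestronglyMeasurable
    (.of_forall fun y s hs => ?_) ((hp t).abs.add (integrable_const _))
    (.of_forall fun y s _ => hW.hasDerivAt_insertNth i y s)).2
  have h1 := ((hW.lipschitz i).comp_insertNth_left i y).dist_le_mul s t
  rw [Real.dist_eq] at h1
  have h2 : (L : ℝ) * dist s t ≤ L * 1 :=
    mul_le_mul_of_nonneg_left (Metric.mem_ball.1 hs).le L.2
  have h3 := abs_sub_abs_le_abs_sub (p i (i.insertNth s y)) (p i (i.insertNth t y))
  rw [Real.norm_eq_abs]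
  linarith

theorem isNicePotential_coordinateUpdate (hW : IsNiceInteraction κ C L W p A) (hκ : 0 < κ)
    (h : ∀ i, IsNicePotential κ K (u i) (v i)) (i : Fin (d + 1)) :
    IsNicePotential κ L (coordinateUpdate u W i) (sectionIntegral u (p i) i) := by
  have := fun j => (h j).isProbabilityMeasure
  have hp : ∀ t, Integrable (fun y => p i (i.insertNth t y))
      (Measure.pi fun j => densityMeasure (u (i.succAbove j))) := fun t =>
    (hW.memLp_deriv_insertNth hκ h i t).integrable one_le_two
  refine isNicePotential_normalize hκ (hW.hasDerivAt_sectionIntegral hκ h i)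
    (fun s t hst => ?_) fun s t hst => ?_ <;> unfold sectionIntegral <;>
    rw [← integral_sub (hp t) (hp s)]
  · simpa using integral_mono (integrable_const _) ((hp t).sub (hp s)) fun y =>
      hW.mul_sub_le i y hst
  · simpa using integral_mono ((hp t).sub (hp s)) (integrable_const _) fun y =>
      hW.sub_le_mul i y hst

theorem meanFieldEnergy_eq (hW : IsNiceInteraction κ C L W p A) (hκ : 0 < κ)
    (h : ∀ i, IsNicePotential κ K (u i) (v i)) (i : Fin (d + 1)) :
    meanFieldEnergy W u = ∫ t, sectionIntegral u W i t ∂densityMeasure (u i)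
      - ∫ t, u i t ∂densityMeasure (u i)
      - ∑ j, ∫ t, u (i.succAbove j) t ∂densityMeasure (u (i.succAbove j)) := by
  have := fun j => (h j).isProbabilityMeasure
  rw [meanFieldEnergy, integral_insertNth_symm i (ν := fun i => densityMeasure (u i))
    (hW.integrable hκ h), Fin.sum_univ_succAbove _ i]
  simp only [sectionIntegral]
  ring

theorem meanFieldEnergy_sub_update (hW : IsNiceInteraction κ C L W p A) (hκ : 0 < κ)
    (h : ∀ i, IsNicePotential κ L (u i) (v i)) (i : Fin (d + 1)) :
    meanFieldEnergy W u - meanFieldEnergy W (Function.update u i (coordinateUpdate u W i)) =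
      ∫ t, (coordinateUpdate u W i t - u i t) ∂densityMeasure (u i) := by
  have := fun j => (h j).isProbabilityMeasure
  have hc := hW.isNicePotential_coordinateUpdate hκ h i
  have := hc.isProbabilityMeasure
  have h' : ∀ j, IsNicePotential κ L (Function.update u i (coordinateUpdate u W i) j)
      (Function.update v i (sectionIntegral u (p i) i) j) := by
    intro j
    rcases eq_or_ne j i with rfl | hj
    · simpa using hc
    · simpa [hj] using h j
  have hs : ∀ w, sectionIntegral (Function.update u i w) W i = sectionIntegral u W i := by
    intro w
    ext t
    simp [sectionIntegral, Fin.succAbove_ne]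
  rw [hW.meanFieldEnergy_eq hκ h i, hW.meanFieldEnergy_eq hκ h' i, hs,
    integral_sub ((h i).integrable_self hc hκ) ((h i).integrable_self (h i) hκ)]
  have hi1 := (h i).integrable_self hc hκ
  have hi2 := hc.integrable_self hc hκ
  have e1 : ∀ t, sectionIntegral u W i t = coordinateUpdate u W i t -
      Real.log (∫ s, Real.exp (-sectionIntegral u W i s)) := fun t => by simp [coordinateUpdate]
  have e2 : ∫ t, sectionIntegral u W i t ∂densityMeasure (u i) =
      ∫ t, coordinateUpdate u W i t ∂densityMeasure (u i) -
      Real.log (∫ s, Real.exp (-sectionIntegral u W i s)) := by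
    rw [integral_congr_ae (.of_forall e1), integral_sub hi1 (integrable_const _)]
    simp
  have e3 : ∫ t, sectionIntegral u W i t ∂densityMeasure (coordinateUpdate u W i) =
      ∫ t, coordinateUpdate u W i t ∂densityMeasure (coordinateUpdate u W i) -
      Real.log (∫ s, Real.exp (-sectionIntegral u W i s)) := by
    rw [integral_congr_ae (.of_forall e1), integral_sub hi2 (integrable_const _)]
    simp
  simp only [Function.update_self, Function.update_of_ne (Fin.succAbove_ne i _)]
  rw [e2, e3]
  ring

theorem exists_isNicePotential (hW : IsNiceInteraction κ C L W p A) (hκ : 0 < κ)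
    (i : Fin (d + 1)) : ∃ u v, IsNicePotential κ L u v :=
  ⟨_, _, isNicePotential_normalize hκ (hW.hasDerivAt_insertNth i 0)
    (fun _ _ hst => hW.mul_sub_le i 0 hst) fun _ _ hst => hW.sub_le_mul i 0 hst⟩

theorem exists_near_minimizer (hW : IsNiceInteraction κ C L W p A) (hκ : 0 < κ) {η : ℝ}
    (hη : 0 < η) : ∃ u v : Fin (d + 1) → ℝ → ℝ, (∀ i, IsNicePotential κ L (u i) (v i)) ∧
      ∀ u' v' : Fin (d + 1) → ℝ → ℝ, (∀ i, IsNicePotential κ L (u' i) (v' i)) →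
        meanFieldEnergy W u ≤ meanFieldEnergy W u' + η := by
  choose u₀ v₀ h₀ using hW.exists_isNicePotential hκ
  set S : Set ℝ := {e | ∃ u v : Fin (d + 1) → ℝ → ℝ,
    (∀ i, IsNicePotential κ L (u i) (v i)) ∧ meanFieldEnergy W u = e}
  have hS : S.Nonempty := ⟨_, u₀, v₀, h₀, rfl⟩
  have hb : BddBelow S := by
    refine ⟨-Real.log (∫ x, Real.exp (-W x)), ?_⟩
    rintro _ ⟨u, v, h, rfl⟩
    exact hW.neg_log_le hκ h
  obtain ⟨_, ⟨u, v, h, rfl⟩, hlt⟩ := exists_lt_of_csInf_lt hS (lt_add_of_pos_right (sInf S) hη)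
  refine ⟨u, v, h, fun u' v' h' => hlt.le.trans ?_⟩
  gcongr
  exact csInf_le hb ⟨u', v', h', rfl⟩

end IsNiceInteraction

namespace IsNiceInteraction

variable {d : ℕ} {κ C K : ℝ} {L : NNReal} {W : (Fin (d + 1) → ℝ) → ℝ}
  {p : Fin (d + 1) → (Fin (d + 1) → ℝ) → ℝ}
  {A : Fin (d + 1) → Fin (d + 1) → (Fin (d + 1) → ℝ) → ℝ} {u v : Fin (d + 1) → ℝ → ℝ}

theorem integrable_hess_sq (hW : IsNiceInteraction κ C L W p A) (hκ : 0 < κ)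
    (h : ∀ i, IsNicePotential κ K (u i) (v i)) (i j : Fin (d + 1)) :
    Integrable (fun x => A i j x ^ 2) (Measure.pi fun i => densityMeasure (u i)) := by
  refine integrable_pi_of_abs_le hκ h (C := C ^ 2) ((hW.continuous_hess i j).pow 2) fun x => ?_
  rw [abs_of_nonneg (sq_nonneg _)]
  have h1 : A i j x ^ 2 ≤ C ^ 2 := sq_le_sq' (neg_le_of_abs_le (hW.hess_le i j x))
    (le_of_abs_le (hW.hess_le i j x))
  have : 0 ≤ ∑ j, x j ^ 2 := Finset.sum_nonneg fun j _ => sq_nonneg _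
  nlinarith [sq_nonneg C]

theorem integral_sq_sub_sectionIntegral_le (hW : IsNiceInteraction κ C L W p A) (hκ : 0 < κ)
    {u' v' : Fin (d + 1) → ℝ → ℝ} {η : ℝ} (hη' : η ≤ 1 / 4)
    (h : ∀ i, IsNicePotential κ L (u i) (v i)) (h' : ∀ i, IsNicePotential κ L (u' i) (v' i))
    (hη : ∀ i, ∫ t, (u' i t - u i t) ∂densityMeasure (u i) ≤ η) (i : Fin (d + 1))
    (hi : MemLp (sectionIntegral u (p i) i) 2 (densityMeasure (u' i))) :
    ∫ x, (sectionIntegral u (p i) i (x i) - p i x) ^ 2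
        ∂(Measure.pi fun i => densityMeasure (u' i)) ≤
      1 / κ * ∑ j, ∫ x, A i (i.succAbove j) x ^ 2 ∂(Measure.pi fun i => densityMeasure (u' i)) +
        (d * √(8 * η * (C ^ 2 / κ))) ^ 2 := by
  have hP := fun j => (h j).isProbabilityMeasure
  have hP' := fun j => (h' j).isProbabilityMeasure
  have hm : MemLp (fun x => sectionIntegral u (p i) i (x i) - p i x) 2
      (Measure.pi fun i => densityMeasure (u' i)) :=
    (hi.comp_measurePreserving (measurePreserving_eval (fun i => densityMeasure (u' i)) i)).sub
      (hW.memLp_deriv hκ h' i)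
  have hA := fun j => hW.integrable_hess_sq hκ h' i (i.succAbove j)
  have hA' := fun j => (_root_.integrable_insertNth (ν := fun i => densityMeasure (u' i)) i
    (hA j)).integral_prod_right
  rw [integral_insertNth_symm i (ν := fun i => densityMeasure (u' i)) hm.integrable_sq]
  have e : ∀ j, ∫ x, A i (i.succAbove j) x ^ 2 ∂(Measure.pi fun i => densityMeasure (u' i)) =
      ∫ t, ∫ y, A i (i.succAbove j) (i.insertNth t y) ^ 2
        ∂(Measure.pi fun j => densityMeasure (u' (i.succAbove j))) ∂densityMeasure (u' i) :=
    fun j => integral_insertNth_symm i (ν := fun i => densityMeasure (u' i)) (hA j)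
  simp only [e]
  rw [← integral_finsetSum _ fun j _ => hA' j, ← integral_const_mul]
  have hR : Integrable (fun t => 1 / κ * ∑ j, ∫ y, A i (i.succAbove j) (i.insertNth t y) ^ 2
        ∂(Measure.pi fun j => densityMeasure (u' (i.succAbove j)))) (densityMeasure (u' i)) :=
    (integrable_finsetSum _ fun j _ => hA' j).const_mul _
  have e2 : ∀ c : ℝ, c = ∫ t, c ∂densityMeasure (u' i) := by simp
  rw [e2 ((d * √(8 * η * (C ^ 2 / κ))) ^ 2), ← integral_add hR (integrable_const _)]
  refine integral_mono (_root_.integrable_insertNth (ν := fun i => densityMeasure (u' i)) i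
    hm.integrable_sq).integral_prod_right (hR.add (integrable_const _)) fun t => ?_
  have hl := (hW.lipschitz i).comp_insertNth_right i t
  have hc : ∀ j, Continuous fun y : Fin d → ℝ => A i (i.succAbove j) (i.insertNth t y) := fun j =>
    (hW.continuous_hess i _).comp ((continuous_insertNth i).comp (by fun_prop :
      Continuous fun y : Fin d → ℝ => (y, t)))
  have hd : ∀ (y : Fin d → ℝ) j s,
      HasDerivAt (fun s => p i (i.insertNth t (Function.update y j s)))
        (A i (i.succAbove j) (i.insertNth t (Function.update y j s))) s := fun y j s => by
    simpa using hW.hasDerivAt_deriv (i.insertNth t y) i (i.succAbove j) s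
  have h1 := poincare_pi hκ d (fun j => h' (i.succAbove j)) hl hc
    (fun j y => hW.hess_le i _ _) hd
  have h2 := abs_integral_pi_sub_le hκ hη' d (fun j => h (i.succAbove j))
    (fun j => h' (i.succAbove j)) (fun j => hη _) hl hc (fun j y => hW.hess_le i _ _) hd
  have h3 := sq_le_sq' (neg_le_of_abs_le h2) (le_of_abs_le h2)
  have hp := hW.memLp_deriv_insertNth hκ h' i t
  have hp1 := hp.integrable one_le_two
  simp only [Fin.insertNth_apply_same]
  set c := sectionIntegral u (p i) i t with hcdef
  have e3 : ∫ y, (c - p i (i.insertNth t y)) ^ 2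
      ∂(Measure.pi fun j => densityMeasure (u' (i.succAbove j))) =
      ∫ y, p i (i.insertNth t y) ^ 2 ∂(Measure.pi fun j => densityMeasure (u' (i.succAbove j)))
      - 2 * c * ∫ y, p i (i.insertNth t y)
        ∂(Measure.pi fun j => densityMeasure (u' (i.succAbove j))) + c ^ 2 := by
    rw [← integral_const_mul, ← integral_sub hp.integrable_sq (hp1.const_mul _)]
    have e4 : c ^ 2 = ∫ y, c ^ 2
      ∂(Measure.pi fun j => densityMeasure (u' (i.succAbove j))) := by simp
    rw [e4, ← integral_add (by exact hp.integrable_sq.sub (hp1.const_mul _)) (integrable_const _)]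
    exact integral_congr_ae (.of_forall fun y => by ring)
  rw [e3]
  change (c - _) ^ 2 ≤ _ at h3
  nlinarith

theorem exists_log_add_meanFieldEnergy_le (hW : IsNiceInteraction κ C L W p A) (hκ : 0 < κ)
    {M ε : ℝ} (hM : ∀ x, ∑ i, ∑ j, A i (i.succAbove j) x ^ 2 ≤ 2 * M) (hε : 0 < ε) :
    ∃ u v : Fin (d + 1) → ℝ → ℝ, (∀ i, IsNicePotential κ L (u i) (v i)) ∧
      Real.log (∫ x, Real.exp (-W x)) + meanFieldEnergy W u ≤ M / κ ^ 2 + ε := by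
  set G : ℝ := (d + 1) * d ^ 2 * (8 * (C ^ 2 / κ)) / (2 * κ) with hG
  have hG0 : 0 ≤ G := by positivity
  set η : ℝ := min (1 / 4) (ε / (1 + G)) with hηdef
  have hη : 0 < η := by positivity
  have hη' : η ≤ 1 / 4 := min_le_left _ _
  obtain ⟨u, v, h, hmin⟩ := hW.exists_near_minimizer hκ hη
  have hu := hW.isNicePotential_coordinateUpdate hκ h
  have hP := fun j => (hu j).isProbabilityMeasure
  refine ⟨coordinateUpdate u W, fun i => sectionIntegral u (p i) i, hu, ?_⟩
  have hdec : ∀ i, ∫ t, (coordinateUpdate u W i t - u i t) ∂densityMeasure (u i) ≤ η := by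
    intro i
    rw [← hW.meanFieldEnergy_sub_update hκ h i]
    have := hmin (Function.update u i (coordinateUpdate u W i))
      (Function.update v i (sectionIntegral u (p i) i)) fun j => by
        rcases eq_or_ne j i with rfl | hj
        · simpa using hu j
        · simpa [hj] using h j
    linarith
  have hi : ∀ i, MemLp (sectionIntegral u (p i) i) 2
      (densityMeasure (coordinateUpdate u W i)) := fun i => by
    obtain ⟨c, -, hc⟩ := (hu i).deriv_sq_le hκ.le
    exact (hu i).memLp_of_sq_le hκ ((hu i).continuous_deriv hκ.le).measurable hc
  have hsq : ∀ i, Integrable (fun x => (sectionIntegral u (p i) i (x i) - p i x) ^ 2)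
      (Measure.pi fun i => densityMeasure (coordinateUpdate u W i)) := fun i =>
    (((hi i).comp_measurePreserving (measurePreserving_eval
      (fun i => densityMeasure (coordinateUpdate u W i)) i)).sub
      (hW.memLp_deriv hκ hu i)).integrable_sq
  have hui : ∀ i, Integrable (fun x => coordinateUpdate u W i (x i))
      (Measure.pi fun i => densityMeasure (coordinateUpdate u W i)) := fun i =>
    integrable_comp_eval (μ := fun i => densityMeasure (coordinateUpdate u W i))
      ((hu i).integrable_self (hu i) hκ)
  have hWi := hW.integrable hκ hu
  have key := log_integral_exp_neg_pi_le hκ hκ (d + 1) hu hW.continuous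
    (.of_forall fun x y => hW.lower x y) hWi (hW.memLp_deriv hκ hu)
  have e1 : ∀ i, ∫ x, coordinateUpdate u W i (x i)
      ∂(Measure.pi fun i => densityMeasure (coordinateUpdate u W i)) =
      ∫ t, coordinateUpdate u W i t ∂densityMeasure (coordinateUpdate u W i) := fun i =>
    integral_comp_eval (μ := fun i => densityMeasure (coordinateUpdate u W i))
      (hu i).continuous.aestronglyMeasurable
  rw [integral_add (by exact (integrable_finsetSum _ fun i _ => hui i).sub hWi)
    (by exact integrable_finsetSum _ fun i _ => (hsq i).div_const _),
    integral_sub (by exact integrable_finsetSum _ fun i _ => hui i) hWi,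
    integral_finsetSum _ fun i _ => hui i,
    integral_finsetSum _ fun i _ => (hsq i).div_const _] at key
  simp only [integral_div, e1] at key
  have hA := fun i j => hW.integrable_hess_sq hκ hu i j
  have hsum : ∑ i : Fin (d + 1), ∑ j : Fin d, ∫ x, A i (i.succAbove j) x ^ 2
      ∂(Measure.pi fun i => densityMeasure (coordinateUpdate u W i)) ≤ 2 * M := by
    simp_rw [← integral_finsetSum _ fun j (_ : j ∈ Finset.univ) => hA _ (Fin.succAbove _ j)]
    rw [← integral_finsetSum _ fun i _ => integrable_finsetSum _ fun j _ => hA i (i.succAbove j)]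
    calc _ ≤ ∫ x, 2 * M ∂(Measure.pi fun i => densityMeasure (coordinateUpdate u W i)) :=
          integral_mono (integrable_finsetSum _ fun i _ => integrable_finsetSum _ fun j _ =>
            hA i (i.succAbove j)) (integrable_const _) hM
      _ = 2 * M := by simp
  have hle : ∑ i, (∫ x, (sectionIntegral u (p i) i (x i) - p i x) ^ 2
      ∂(Measure.pi fun i => densityMeasure (coordinateUpdate u W i))) / (2 * κ) ≤
      M / κ ^ 2 + G * η := by
    calc _ ≤ ∑ i : Fin (d + 1), (1 / κ * ∑ j, ∫ x, A i (i.succAbove j) x ^ 2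
            ∂(Measure.pi fun i => densityMeasure (coordinateUpdate u W i)) +
            d ^ 2 * (8 * η * (C ^ 2 / κ))) / (2 * κ) := by
          gcongr with i
          refine (hW.integral_sq_sub_sectionIntegral_le hκ hη' h hu hdec i (hi i)).trans_eq ?_
          rw [mul_pow, Real.sq_sqrt (by positivity)]
      _ = (1 / κ * ∑ i : Fin (d + 1), ∑ j, ∫ x, A i (i.succAbove j) x ^ 2
            ∂(Measure.pi fun i => densityMeasure (coordinateUpdate u W i))) / (2 * κ) + G * η := by
          rw [← Finset.sum_div, Finset.sum_add_distrib, ← Finset.mul_sum, hG]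
          simp
          ring
      _ ≤ (1 / κ * (2 * M)) / (2 * κ) + G * η := by gcongr
      _ = _ := by field_simp
  have hGη : G * η ≤ ε := by
    have : η ≤ ε / (1 + G) := min_le_right _ _
    rw [le_div_iff₀ (by positivity)] at this
    nlinarith
  rw [meanFieldEnergy]
  linarith

end IsNiceInteraction

theorem ContDiff.hasDerivAt_deriv_two {f : ℝ → ℝ} (hf : ContDiff ℝ 2 f) :
    (∀ x, HasDerivAt f (deriv f x) x) ∧ (∀ x, HasDerivAt (deriv f) (deriv (deriv f) x) x) ∧
      Continuous (deriv (deriv f)) := by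
  have h1 : ContDiff ℝ 1 (deriv f) := (contDiff_succ_iff_deriv (n := 1).1 hf).2.2
  exact ⟨fun x => (hf.differentiable two_ne_zero x).hasDerivAt,
    fun x => (h1.differentiable one_ne_zero x).hasDerivAt, h1.continuous_deriv le_rfl⟩

theorem ContDiff.mul_sub_le_deriv_sub {f : ℝ → ℝ} {c : ℝ} (hf : ContDiff ℝ 2 f)
    (hc : ∀ x, c ≤ deriv (deriv f) x) (x y : ℝ) (hxy : x ≤ y) :
    c * (y - x) ≤ deriv f y - deriv f x :=
  mul_sub_le_image_sub_of_le_deriv (fun x => (hf.hasDerivAt_deriv_two.2.1 x).differentiableAt)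
    hc hxy

theorem ContDiff.paraboloid_le {f : ℝ → ℝ} {c : ℝ} (hf : ContDiff ℝ 2 f)
    (hc : ∀ x, c ≤ deriv (deriv f) x) (x y : ℝ) :
    f x + deriv f x * (y - x) + c / 2 * (y - x) ^ 2 ≤ f y :=
  quadratic_lower_bound hf.hasDerivAt_deriv_two.1 (hf.mul_sub_le_deriv_sub hc) x y

theorem ContDiff.abs_deriv_sub_le {f : ℝ → ℝ} {C : ℝ} (hf : ContDiff ℝ 2 f)
    (hC : ∀ x, |deriv (deriv f) x| ≤ C) (x y : ℝ) :
    |deriv f x - deriv f y| ≤ C * |x - y| := by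
  have := (lipschitzWith_of_hasDerivAt_bounded hf.hasDerivAt_deriv_two.2.1 hC).dist_le_mul x y
  rwa [Real.coe_toNNReal _ ((abs_nonneg _).trans (hC 0))] at this

/-- The `β`-dependent part of the potential of the posterior, with the location `ϑ` fixed. -/
noncomputable def glmPotential {n d : ℕ} (X : Fin n → Fin d → ℝ) (w : Fin d → ℝ) (cσ : ℝ)
    (ψ ϱ : ℝ → ℝ) (ϑ : ℝ) (x : Fin d → ℝ) : ℝ :=
  -(∑ j, w j * x j) + (∑ l, ψ (∑ j, X l j * x j)) / cσ + ∑ j, ϱ (x j - ϑ)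

theorem hasDerivAt_dotProduct_update {d : ℕ} (c x : Fin d → ℝ) (i : Fin d) (s : ℝ) :
    HasDerivAt (fun s => ∑ j, c j * Function.update x i s j) (c i) s := by
  have h := hasDerivAt_pi.1 (hasDerivAt_update x i s)
  have := HasDerivAt.fun_sum fun j (_ : j ∈ Finset.univ) => (h j).const_mul (c j)
  exact this.congr_deriv (by simp [Pi.single_apply])

theorem exists_isNiceInteraction_glm {n d : ℕ} {X : Fin n → Fin d → ℝ} (w : Fin d → ℝ) {cσ : ℝ}
    (hcσ : 0 < cσ) {ψ ϱ : ℝ → ℝ} (hψ : ContDiff ℝ 2 ψ) (hϱ : ContDiff ℝ 2 ϱ) {a b B R : ℝ}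
    (hb : 0 < b) (hψ'' : ∀ t, b ≤ deriv (deriv ψ) t ∧ deriv (deriv ψ) t ≤ B)
    (hϱ'' : ∀ t, 0 ≤ deriv (deriv ϱ) t ∧ deriv (deriv ϱ) t ≤ R)
    (hA : ∀ v : Fin d → ℝ,
      a * ∑ j, v j ^ 2 ≤ ∑ i, ∑ j, v i * (cσ⁻¹ * ∑ l, X l i * X l j) * v j) :
    ∃ (C : ℝ) (L : NNReal) (p : ℝ → Fin d → (Fin d → ℝ) → ℝ), ∀ ϑ,
      IsNiceInteraction (a * b) C L (glmPotential X w cσ ψ ϱ ϑ) (p ϑ)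
        fun i j x => cσ⁻¹ * ∑ l, deriv (deriv ψ) (∑ r, X l r * x r) * X l i * X l j +
          if i = j then deriv (deriv ϱ) (x i - ϑ) else 0 := by
  have hψa : ∀ t, |deriv (deriv ψ) t| ≤ B := fun t =>
    abs_le.2 ⟨by linarith [hψ'' t], (hψ'' t).2⟩
  have hϱa : ∀ t, |deriv (deriv ϱ) t| ≤ R := fun t =>
    abs_le.2 ⟨by linarith [hϱ'' t], (hϱ'' t).2⟩
  have hB : 0 ≤ B := (abs_nonneg _).trans (hψa 0)
  have hR : 0 ≤ R := (abs_nonneg _).trans (hϱa 0)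
  obtain ⟨dψ, ddψ, cψ⟩ := hψ.hasDerivAt_deriv_two
  obtain ⟨dϱ, ddϱ, cϱ⟩ := hϱ.hasDerivAt_deriv_two
  set Li : Fin d → ℝ := fun i => (∑ l, |X l i| * (B * ∑ j, |X l j|)) / cσ + R with hLi
  have hLi0 : ∀ i, 0 ≤ Li i := fun i => by positivity
  set Cij : Fin d → Fin d → ℝ := fun i j => cσ⁻¹ * ∑ l, B * |X l i| * |X l j| + R with hCij
  have hCij0 : ∀ i j, 0 ≤ Cij i j := fun i j => by positivity
  refine ⟨∑ i, ∑ j, Cij i j, (∑ i, Li i).toNNReal, fun ϑ i x => -w i +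
    (∑ l, X l i * deriv ψ (∑ j, X l j * x j)) / cσ + deriv ϱ (x i - ϑ), fun ϑ => ?_⟩
  refine ⟨?_, fun x y => ?_, fun x i s => ?_, fun i => ?_, fun x i j s => ?_, fun i j => ?_,
    fun i j x => ?_⟩
  · have := hψ.continuous
    have := hϱ.continuous
    unfold glmPotential
    fun_prop
  · have h1 : ∀ l, ψ (∑ j, X l j * x j) + deriv ψ (∑ j, X l j * x j) *
        (∑ j, X l j * (y j - x j)) + b / 2 * (∑ j, X l j * (y j - x j)) ^ 2 ≤
        ψ (∑ j, X l j * y j) := fun l => by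
      have := hψ.paraboloid_le (fun t => (hψ'' t).1) (∑ j, X l j * x j) (∑ j, X l j * y j)
      simpa only [← Finset.sum_sub_distrib, ← mul_sub] using this
    have h2 : ∀ j, ϱ (x j - ϑ) + deriv ϱ (x j - ϑ) * (y j - x j) ≤ ϱ (y j - ϑ) := fun j => by
      have := hϱ.paraboloid_le (fun t => (hϱ'' t).1) (x j - ϑ) (y j - ϑ)
      simpa using this
    have h3 := hA fun j => y j - x j
    have h4 : ∑ i, ∑ j, (y i - x i) * (cσ⁻¹ * ∑ l, X l i * X l j) * (y j - x j) =
        (∑ l, (∑ j, X l j * (y j - x j)) ^ 2) / cσ := by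
      have h5 : ∀ i j, (y i - x i) * (cσ⁻¹ * ∑ l, X l i * X l j) * (y j - x j) =
          ∑ l, (X l i * (y i - x i)) * (X l j * (y j - x j)) / cσ := fun i j => by
        rw [Finset.mul_sum, Finset.mul_sum, Finset.sum_mul]
        exact Finset.sum_congr rfl fun l _ => by ring
      simp only [h5, sq, Finset.sum_mul_sum, Finset.sum_div]
      rw [Finset.sum_comm]
      rw [Finset.sum_congr rfl fun i _ => Finset.sum_comm]
      rw [Finset.sum_comm]
      exact Finset.sum_congr rfl fun l _ => Finset.sum_comm
    rw [h4] at h3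
    have h6 := div_le_div_of_nonneg_right (Finset.sum_le_sum fun l (_ : l ∈ Finset.univ) => h1 l)
      hcσ.le
    have h7 := Finset.sum_le_sum fun l (_ : l ∈ Finset.univ) => h2 l
    rw [Finset.sum_add_distrib, Finset.sum_add_distrib, ← Finset.mul_sum, add_div, add_div,
      mul_div_assoc] at h6
    rw [Finset.sum_add_distrib] at h7
    have h8 := mul_le_mul_of_nonneg_left h3 (half_pos hb).le
    have h9 : (∑ l, deriv ψ (∑ j, X l j * x j) * ∑ j, X l j * (y j - x j)) / cσ =
        ∑ i, (∑ l, X l i * deriv ψ (∑ j, X l j * x j)) / cσ * (y i - x i) := by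
      simp only [Finset.mul_sum, Finset.sum_div, Finset.sum_mul]
      rw [Finset.sum_comm]
      exact Finset.sum_congr rfl fun i _ => Finset.sum_congr rfl fun l _ => by ring
    simp only [add_mul, Finset.sum_add_distrib, glmPotential]
    rw [← h9]
    have h10 : ∑ i, -w i * (y i - x i) = -(∑ j, w j * y j) + ∑ j, w j * x j := by
      rw [← Finset.sum_neg_distrib, ← Finset.sum_add_distrib]
      exact Finset.sum_congr rfl fun i _ => by ring
    rw [h10]
    linarith
  · refine .add (.add (hasDerivAt_dotProduct_update w x i s).fun_neg ?_) ?_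
    · refine ((HasDerivAt.fun_sum fun l _ => (dψ _).comp s
        (hasDerivAt_dotProduct_update (X l) x i s)).div_const cσ).congr_deriv ?_
      simp only [mul_comm]
    · have h := hasDerivAt_pi.1 (hasDerivAt_update x i s)
      have := HasDerivAt.fun_sum fun j (_ : j ∈ Finset.univ) =>
        (dϱ (Function.update x i s j - ϑ)).comp s ((h j).sub_const ϑ)
      exact this.congr_deriv (by simp [Pi.single_apply])
  · refine LipschitzWith.of_dist_le_mul fun x y => ?_
    rw [Real.coe_toNNReal _ (Finset.sum_nonneg fun i _ => hLi0 i)]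
    have hc : ∀ j, |x j - y j| ≤ dist x y := fun j => dist_le_pi_dist x y j
    have h1 : ∀ l, |(∑ j, X l j * x j) - ∑ j, X l j * y j| ≤ (∑ j, |X l j|) * dist x y := by
      intro l
      rw [← Finset.sum_sub_distrib, Finset.sum_mul]
      refine (Finset.abs_sum_le_sum_abs _ _).trans (Finset.sum_le_sum fun j _ => ?_)
      rw [← mul_sub, abs_mul]
      exact mul_le_mul_of_nonneg_left (hc j) (abs_nonneg _)
    have h2 : |(∑ l, X l i * deriv ψ (∑ j, X l j * x j)) -
        ∑ l, X l i * deriv ψ (∑ j, X l j * y j)| ≤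
        ∑ l, |X l i| * (B * ((∑ j, |X l j|) * dist x y)) := by
      rw [← Finset.sum_sub_distrib]
      refine (Finset.abs_sum_le_sum_abs _ _).trans (Finset.sum_le_sum fun l _ => ?_)
      rw [← mul_sub, abs_mul]
      gcongr
      exact (hψ.abs_deriv_sub_le hψa _ _).trans (mul_le_mul_of_nonneg_left (h1 l) hB)
    have h3 : |deriv ϱ (x i - ϑ) - deriv ϱ (y i - ϑ)| ≤ R * dist x y := by
      refine (hϱ.abs_deriv_sub_le hϱa _ _).trans (mul_le_mul_of_nonneg_left ?_ hR)
      simpa using hc i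
    calc _ = |((∑ l, X l i * deriv ψ (∑ j, X l j * x j)) -
            ∑ l, X l i * deriv ψ (∑ j, X l j * y j)) / cσ +
            (deriv ϱ (x i - ϑ) - deriv ϱ (y i - ϑ))| := by
          rw [Real.dist_eq]; congr 1; ring
      _ ≤ (∑ l, |X l i| * (B * ((∑ j, |X l j|) * dist x y))) / cσ + R * dist x y := by
          refine (abs_add_le _ _).trans (add_le_add ?_ h3)
          rw [abs_div, abs_of_pos hcσ]
          gcongr
      _ = Li i * dist x y := by
          simp only [hLi, add_mul, div_mul_eq_mul_div, Finset.sum_mul, mul_assoc]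
      _ ≤ _ := by
          gcongr
          exact Finset.single_le_sum (fun i _ => hLi0 i) (Finset.mem_univ i)
  · refine .add ((((HasDerivAt.fun_sum fun l _ => ((ddψ _).comp s
      (hasDerivAt_dotProduct_update (X l) x j s)).const_mul (X l i)).div_const cσ).const_add
        (-w i)).congr_deriv ?_) ?_
    · rw [div_eq_inv_mul]
      exact congrArg _ (Finset.sum_congr rfl fun l _ => by ring)
    · have h := (hasDerivAt_pi.1 (hasDerivAt_update x j s) i).sub_const ϑ
      refine ((ddϱ _).comp s h).congr_deriv ?_
      simp [Pi.single_apply]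
  · refine .add (by fun_prop) ?_
    split_ifs
    · fun_prop
    · fun_prop
  · calc _ ≤ Cij i j := by
          refine (abs_add_le _ _).trans (add_le_add ?_ ?_)
          · rw [abs_mul, abs_of_pos (inv_pos.2 hcσ)]
            gcongr
            refine (Finset.abs_sum_le_sum_abs _ _).trans (Finset.sum_le_sum fun l _ => ?_)
            rw [abs_mul, abs_mul]
            gcongr
            exact hψa _
          · split_ifs
            · exact hϱa _
            · simpa using hR
      _ ≤ ∑ j, Cij i j := Finset.single_le_sum (fun j _ => hCij0 i j) (Finset.mem_univ j)
      _ ≤ _ := Finset.single_le_sum (f := fun i => ∑ j, Cij i j)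
          (fun i _ => Finset.sum_nonneg fun j _ => hCij0 i j) (Finset.mem_univ i)

theorem continuous_integral_of_convexOn {Ω : Type*} [MeasurableSpace Ω] {μ : Measure Ω}
    {f : ℝ → Ω → ℝ} (hf : ∀ ω, ConvexOn ℝ univ fun t => f t ω) (hi : ∀ t, Integrable (f t) μ) :
    Continuous fun t => ∫ ω, f t ω ∂μ := by
  rw [← continuousOn_univ]
  refine ConvexOn.continuousOn isOpen_univ ⟨convex_univ, fun s _ t _ a b ha hb hab => ?_⟩
  simp only [smul_eq_mul]
  rw [← integral_const_mul, ← integral_const_mul,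
    ← integral_add ((hi s).const_mul a) ((hi t).const_mul b)]
  exact integral_mono (hi _) (((hi s).const_mul a).add ((hi t).const_mul b)) fun ω =>
    (hf ω).2 (mem_univ s) (mem_univ t) ha hb hab

section Family

variable {d : ℕ} {W : ℝ → (Fin d → ℝ) → ℝ} {W₀ : (Fin d → ℝ) → ℝ} {c : ℝ}

theorem continuous_integral_exp_neg (hWc : Continuous fun z : ℝ × (Fin d → ℝ) => W z.1 z.2)
    (hW₀ : Integrable fun x => Real.exp (-W₀ x)) (hlow : ∀ ϑ x, W₀ x + c * ϑ ≤ W ϑ x) :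
    Continuous fun ϑ => ∫ x, Real.exp (-W ϑ x) := by
  have h : Continuous fun ϑ => ∫ x, Real.exp (-W ϑ x + c * ϑ) := by
    refine continuous_of_dominated (bound := fun x => Real.exp (-W₀ x)) (fun ϑ => ?_)
      (fun ϑ => .of_forall fun x => ?_) hW₀ (.of_forall fun x => ?_)
    · have : Continuous (W ϑ) := hWc.comp (by fun_prop : Continuous fun x => (ϑ, x))
      exact (by fun_prop : Continuous fun x => Real.exp (-W ϑ x + c * ϑ)).aestronglyMeasurable
    · rw [Real.norm_eq_abs, Real.abs_exp]
      exact Real.exp_le_exp.2 (by linarith [hlow ϑ x])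
    · have : Continuous fun ϑ => W ϑ x := hWc.comp (by fun_prop : Continuous fun ϑ => (ϑ, x))
      fun_prop
  have e : (fun ϑ => ∫ x, Real.exp (-W ϑ x)) =
      fun ϑ => Real.exp (-(c * ϑ)) * ∫ x, Real.exp (-W ϑ x + c * ϑ) := by
    ext ϑ
    rw [← integral_const_mul]
    exact integral_congr_ae (.of_forall fun x => by
      simp only [← Real.exp_add]
      congr 1
      ring)
  rw [e]
  fun_prop

theorem integrable_exp_neg_add (hWc : Continuous fun z : ℝ × (Fin d → ℝ) => W z.1 z.2)
    (hW₀ : Integrable fun x => Real.exp (-W₀ x)) (hlow : ∀ ϑ x, W₀ x + c * ϑ ≤ W ϑ x)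
    {g : ℝ → ℝ} (hgc : Continuous g) (hg : Integrable fun ϑ => Real.exp (-(g ϑ + c * ϑ))) :
    Integrable fun z : ℝ × (Fin d → ℝ) => Real.exp (-(g z.1 + W z.1 z.2)) := by
  refine (hg.mul_prod hW₀).mono'
    (by fun_prop : Continuous fun z : ℝ × (Fin d → ℝ) =>
      Real.exp (-(g z.1 + W z.1 z.2))).aestronglyMeasurable (.of_forall fun z => ?_)
  rw [Real.norm_eq_abs, Real.abs_exp, ← Real.exp_add]
  exact Real.exp_le_exp.2 (by linarith [hlow z.1 z.2])

end Family

theorem exists_measurable_selection {ι : Type*} {D : ι → ℝ → ℝ} [Nonempty ι] {m ε : ℝ} (hε : 0 < ε)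
    (hD : ∀ k, Continuous (D k)) (h : ∀ ϑ, ∃ k, D k ϑ ≤ m) :
    ∃ (N : ℝ → ℕ) (e : ℕ → ι), Measurable N ∧ ∀ ϑ, D (e (N ϑ)) ϑ ≤ m + ε := by
  choose k hk using h
  obtain ⟨s, hs, hcov⟩ := TopologicalSpace.countable_cover_nhds
    (f := fun ϑ => {τ | D (k ϑ) τ < m + ε}) fun ϑ =>
      (hD (k ϑ)).continuousAt.eventually_lt continuousAt_const (by linarith [hk ϑ])
  have hne : s.Nonempty := by
    rcases s.eq_empty_or_nonempty with rfl | hne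
    · simp [eq_comm (a := (∅ : Set ℝ))] at hcov
    · exact hne
  obtain ⟨e, rfl⟩ := hs.exists_eq_range hne
  have hex : ∀ τ, ∃ j, D (k (e j)) τ < m + ε := fun τ => by
    have : τ ∈ ⋃ x ∈ range e, {τ | D (k x) τ < m + ε} := hcov ▸ mem_univ τ
    simpa using this
  classical
  refine ⟨fun τ => Nat.find (hex τ), k ∘ e, measurable_find hex fun j => ?_, fun τ =>
    (Nat.find_spec (hex τ)).le⟩
  exact (isOpen_lt (hD _) continuous_const).measurableSet

theorem IsNiceInteraction.exists_measurable_selection {d : ℕ} {κ C : ℝ} {L : NNReal}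
    {W : ℝ → (Fin (d + 1) → ℝ) → ℝ} {p : ℝ → Fin (d + 1) → (Fin (d + 1) → ℝ) → ℝ}
    {A : ℝ → Fin (d + 1) → Fin (d + 1) → (Fin (d + 1) → ℝ) → ℝ} {W₀ : (Fin (d + 1) → ℝ) → ℝ}
    {c M ε : ℝ} (hκ : 0 < κ) (hW : ∀ ϑ, IsNiceInteraction κ C L (W ϑ) (p ϑ) (A ϑ))
    (hM : ∀ ϑ x, ∑ i, ∑ j, A ϑ i (i.succAbove j) x ^ 2 ≤ 2 * M)
    (hWc : Continuous fun z : ℝ × (Fin (d + 1) → ℝ) => W z.1 z.2)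
    (hW₀ : Integrable fun x => Real.exp (-W₀ x)) (hlow : ∀ ϑ x, W₀ x + c * ϑ ≤ W ϑ x)
    (hconv : ∀ x, ConvexOn ℝ univ fun ϑ => W ϑ x) (hε : 0 < ε) :
    ∃ (N : ℝ → ℕ) (u v : ℕ → Fin (d + 1) → ℝ → ℝ), Measurable N ∧
      (∀ k i, IsNicePotential κ L (u k i) (v k i)) ∧
      ∀ ϑ, Real.log (∫ x, Real.exp (-W ϑ x)) + meanFieldEnergy (W ϑ) (u (N ϑ)) ≤
        M / κ ^ 2 + ε := by
  let ι := {q : (Fin (d + 1) → ℝ → ℝ) × (Fin (d + 1) → ℝ → ℝ) //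
    ∀ i, IsNicePotential κ L (q.1 i) (q.2 i)}
  have hex : ∀ ϑ, ∃ q : ι, Real.log (∫ x, Real.exp (-W ϑ x)) + meanFieldEnergy (W ϑ) q.1.1 ≤
      M / κ ^ 2 + ε / 2 := fun ϑ => by
    obtain ⟨u, v, h, hle⟩ := (hW ϑ).exists_log_add_meanFieldEnergy_le hκ (hM ϑ) (half_pos hε)
    exact ⟨⟨(u, v), h⟩, hle⟩
  have : Nonempty ι := ⟨(hex 0).choose⟩
  have hZ := continuous_integral_exp_neg hWc hW₀ hlow
  obtain ⟨N, e, hN, hle⟩ := _root_.exists_measurable_selection (half_pos hε)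
    (D := fun (q : ι) ϑ => Real.log (∫ x, Real.exp (-W ϑ x)) + meanFieldEnergy (W ϑ) q.1.1)
    (fun q => by
      refine .add (hZ.log fun ϑ => ?_) (.sub (continuous_integral_of_convexOn hconv fun ϑ =>
        (hW ϑ).integrable hκ q.2) continuous_const)
      exact (integral_exp_pos ((hW ϑ).integrable_exp hκ)).ne') hex
  refine ⟨N, fun k => (e k).1.1, fun k => (e k).1.2, hN, fun k => (e k).2, fun ϑ => ?_⟩
  refine (hle ϑ).trans_eq ?_
  ring

theorem starMeasure_eq_compProd {k : ℕ} (μ₁ : Measure ℝ) [SFinite μ₁] (κ : Fin k → Kernel ℝ ℝ)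
    (η : Kernel ℝ (Fin k → ℝ)) [IsSFiniteKernel η] (hη : ∀ z, η z = Measure.pi fun j => κ j z) :
    starMeasure μ₁ κ = μ₁ ⊗ₘ η := by
  rw [Measure.compProd_eq_comp_prod, starMeasure]
  congr 1
  ext1 z
  rw [Kernel.prod_apply, Kernel.id_apply, hη]

theorem compProd_withDensity_withDensity {E F : Type*} [MeasurableSpace E] [MeasurableSpace F]
    {μ : Measure E} {ν : Measure F} [SFinite μ] [SFinite ν] {η : Kernel E F} [IsSFiniteKernel η]
    {q : E → ℝ≥0∞} {r : E × F → ℝ≥0∞} (hq : Measurable q) (hr : Measurable r)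
    (hη : ∀ z, η z = ν.withDensity fun x => r (z, x)) :
    μ.withDensity q ⊗ₘ η = (μ.prod ν).withDensity fun z => q z.1 * r z := by
  ext s hs
  have hm : Measurable (s.indicator fun z => q z.1 * r z) :=
    ((hq.comp measurable_fst).mul hr).indicator hs
  rw [Measure.compProd_apply hs, lintegral_withDensity_eq_lintegral_mul _ hq
    (Kernel.measurable_kernel_prodMk_left hs), withDensity_apply _ hs, ← lintegral_indicator hs,
    lintegral_prod _ hm.aemeasurable]
  refine lintegral_congr fun z => ?_
  rw [Pi.mul_apply, hη, withDensity_apply _ (measurable_prodMk_left hs),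
    ← lintegral_indicator (measurable_prodMk_left hs), ← lintegral_const_mul _
      (by exact (hr.comp measurable_prodMk_left).indicator (measurable_prodMk_left hs))]
  refine lintegral_congr fun x => ?_
  by_cases h : (z, x) ∈ s <;> simp [h]

theorem KL_withDensity_exp {E : Type*} [MeasurableSpace E] {μ π : Measure E} [SigmaFinite π]
    {f : E → ℝ} (hf : Measurable f) (hμ : μ = π.withDensity fun z => ENNReal.ofReal (Real.exp (f z)))
    (hi : Integrable f μ) : KL μ π = ENNReal.ofReal (∫ z, f z ∂μ) := by
  have hac : μ ≪ π := hμ ▸ withDensity_absolutelyContinuous _ _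
  have hr : (fun z => Real.log (μ.rnDeriv π z).toReal) =ᵐ[μ] f := by
    have : μ.rnDeriv π =ᵐ[π] fun z => ENNReal.ofReal (Real.exp (f z)) :=
      hμ ▸ Measure.rnDeriv_withDensity _ (by fun_prop)
    filter_upwards [hac.ae_le this] with z hz
    rw [hz, ENNReal.toReal_ofReal (Real.exp_pos _).le, Real.log_exp]
  rw [KL, if_pos ⟨hac, hi.congr hr.symm⟩, integral_congr_ae hr]

theorem gibbs_eq_withDensity {E : Type*} [MeasureSpace E] {V : E → ℝ}
    [NeZero (volume : Measure E)]
    (hV : Integrable fun z => Real.exp (-V z)) :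
    gibbs V = volume.withDensity
      fun z => ENNReal.ofReal (Real.exp (-(V z + Real.log (∫ z, Real.exp (-V z))))) := by
  have hZ := integral_exp_pos hV
  rw [gibbs, withDensity_apply _ MeasurableSet.univ, Measure.restrict_univ,
    ← ofReal_integral_eq_lintegral_ofReal hV (.of_forall fun z => (Real.exp_pos _).le),
    ← ENNReal.ofReal_inv_of_pos hZ, ← withDensity_smul' _ _ ENNReal.ofReal_ne_top]
  congr 1
  ext z
  rw [Pi.smul_apply, smul_eq_mul, ← ENNReal.ofReal_mul (by positivity), neg_add, Real.exp_add,
    Real.exp_neg (Real.log _), Real.exp_log hZ, mul_comm]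

theorem sigmaFinite_gibbs {E : Type*} [MeasureSpace E] {V : E → ℝ} [NeZero (volume : Measure E)]
    [SigmaFinite (volume : Measure E)] (hV : Integrable fun z => Real.exp (-V z)) :
    SigmaFinite (gibbs V) := by
  rw [gibbs_eq_withDensity hV]
  exact SigmaFinite.withDensity_ofReal _

theorem IsNiceInteraction.exists_isStar_KL_le {d : ℕ} {κ C B : ℝ} {L : NNReal}
    {W : ℝ → (Fin (d + 1) → ℝ) → ℝ} {p : ℝ → Fin (d + 1) → (Fin (d + 1) → ℝ) → ℝ}
    {A : ℝ → Fin (d + 1) → Fin (d + 1) → (Fin (d + 1) → ℝ) → ℝ} {W₀ : (Fin (d + 1) → ℝ) → ℝ}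
    {c : ℝ} (hκ : 0 < κ) (hW : ∀ ϑ, IsNiceInteraction κ C L (W ϑ) (p ϑ) (A ϑ))
    (hWc : Continuous fun z : ℝ × (Fin (d + 1) → ℝ) => W z.1 z.2)
    (hW₀ : Integrable fun x => Real.exp (-W₀ x)) (hlow : ∀ ϑ x, W₀ x + c * ϑ ≤ W ϑ x)
    {g : ℝ → ℝ} (hgc : Continuous g) (hg : Integrable fun ϑ => Real.exp (-(g ϑ + c * ϑ)))
    {N : ℝ → ℕ} {u v : ℕ → Fin (d + 1) → ℝ → ℝ} (hN : Measurable N)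
    (h : ∀ k i, IsNicePotential κ L (u k i) (v k i))
    (hB : ∀ ϑ, Real.log (∫ x, Real.exp (-W ϑ x)) + meanFieldEnergy (W ϑ) (u (N ϑ)) ≤ B) :
    ∃ μ, IsStar μ ∧
      KL μ (gibbs fun z : ℝ × (Fin (d + 1) → ℝ) => g z.1 + W z.1 z.2) ≤ ENNReal.ofReal B := by
  have hP := fun k i => (h k i).isProbabilityMeasure
  set V : ℝ × (Fin (d + 1) → ℝ) → ℝ := fun z => g z.1 + W z.1 z.2 with hV
  set Zϑ : ℝ → ℝ := fun ϑ => ∫ x, Real.exp (-W ϑ x) with hZϑ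
  have hZϑpos : ∀ ϑ, 0 < Zϑ ϑ := fun ϑ => integral_exp_pos ((hW ϑ).integrable_exp hκ)
  have hZϑc : Continuous Zϑ := continuous_integral_exp_neg hWc hW₀ hlow
  have hVi : Integrable fun z => Real.exp (-V z) := integrable_exp_neg_add hWc hW₀ hlow hgc hg
  have hVc : Continuous V := by fun_prop
  set Z : ℝ := ∫ z, Real.exp (-V z) with hZ
  have hZpos : 0 < Z := integral_exp_pos hVi
  set q : ℝ → ℝ := fun ϑ => Real.exp (-(g ϑ - Real.log (Zϑ ϑ) + Real.log Z)) with hq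
  have hqm : Measurable q := by
    have := hZϑc.measurable
    have := hgc.measurable
    fun_prop
  set U : ℝ × (Fin (d + 1) → ℝ) → ℝ := fun z => ∑ i, u (N z.1) i (z.2 i) with hU
  have hUm : Measurable U := by
    have : Measurable fun z : ℕ × (Fin (d + 1) → ℝ) => ∑ i, u z.1 i (z.2 i) :=
      measurable_from_prod_countable_right fun k => Finset.measurable_sum _ fun i _ =>
        (h k i).continuous.measurable.comp (measurable_pi_apply i)
    exact this.comp ((hN.comp measurable_fst).prodMk measurable_snd)
  have hqint : Integrable q ∧ ∫ ϑ, q ϑ = 1 := by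
    rw [Measure.volume_eq_prod] at hVi
    have e : q = fun ϑ => (∫ x, Real.exp (-V (ϑ, x))) / Z := by
      ext ϑ
      simp only [hq, hV, neg_add, Real.exp_add, integral_const_mul]
      rw [neg_sub, sub_eq_add_neg, Real.exp_add, Real.exp_neg (Real.log Z), Real.exp_log hZpos,
        Real.exp_log (hZϑpos ϑ), mul_comm (Zϑ ϑ), div_eq_mul_inv]
    rw [e, integral_div, ← integral_prod _ hVi, ← Measure.volume_eq_prod, ← hZ,
      div_self hZpos.ne']
    exact ⟨hVi.integral_prod_left.div_const _, rfl⟩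
  set π₁ : Measure ℝ := volume.withDensity fun ϑ => ENNReal.ofReal (q ϑ) with hπ₁
  have : IsProbabilityMeasure π₁ := ⟨by
    rw [hπ₁, withDensity_apply _ MeasurableSet.univ, Measure.restrict_univ,
      ← ofReal_integral_eq_lintegral_ofReal hqint.1 (.of_forall fun ϑ => (Real.exp_pos _).le),
      hqint.2, ENNReal.ofReal_one]⟩
  let ν : Fin (d + 1) → Kernel ℝ ℝ := fun i =>
    (Kernel.ofFunOfCountable fun k => densityMeasure (u k i)).comap N hN
  let η : Kernel ℝ (Fin (d + 1) → ℝ) :=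
    (Kernel.ofFunOfCountable fun k => Measure.pi fun i => densityMeasure (u k i)).comap N hN
  have hν : ∀ i, IsMarkovKernel (ν i) := fun i => ⟨fun ϑ => hP (N ϑ) i⟩
  have hηm : IsMarkovKernel η := ⟨fun ϑ => by
    change IsProbabilityMeasure (Measure.pi fun i => densityMeasure (u (N ϑ) i))
    infer_instance⟩
  have hηd : ∀ ϑ, η ϑ = volume.withDensity fun x => ENNReal.ofReal (Real.exp (-U (ϑ, x))) :=
    fun ϑ => pi_densityMeasure fun i => (h (N ϑ) i).integrable_exp
  have hμ : starMeasure π₁ ν = π₁ ⊗ₘ η := starMeasure_eq_compProd π₁ ν η fun ϑ => rfl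
  set f : ℝ × (Fin (d + 1) → ℝ) → ℝ := fun z => W z.1 z.2 + Real.log (Zϑ z.1) - U z with hf
  have hfm : Measurable f := by
    have := hZϑc.measurable
    have := hWc.measurable
    fun_prop
  have hμd : starMeasure π₁ ν = (gibbs V).withDensity
      fun z => ENNReal.ofReal (Real.exp (f z)) := by
    rw [hμ, compProd_withDensity_withDensity (by fun_prop)
      (r := fun z => ENNReal.ofReal (Real.exp (-U z))) (by fun_prop) hηd,
      gibbs_eq_withDensity hVi, ← hZ, ← withDensity_mul _ (by fun_prop) (by fun_prop),
      Measure.volume_eq_prod]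
    congr 1
    ext z
    rw [Pi.mul_apply, ← ENNReal.ofReal_mul (Real.exp_pos _).le,
      ← ENNReal.ofReal_mul (Real.exp_pos _).le, ← Real.exp_add, ← Real.exp_add]
    congr 2
    simp only [hf, hV]
    ring
  have hui : ∀ ϑ i, Integrable (fun x => u (N ϑ) i (x i))
      (Measure.pi fun i => densityMeasure (u (N ϑ) i)) := fun ϑ i =>
    integrable_comp_eval (μ := fun i => densityMeasure (u (N ϑ) i))
      ((h (N ϑ) i).integrable_self (h (N ϑ) i) hκ)
  have hfi : ∀ ϑ, Integrable (fun x => f (ϑ, x)) (η ϑ) := fun ϑ =>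
    (((hW ϑ).integrable hκ (h (N ϑ))).add (integrable_const (Real.log (Zϑ ϑ)))).sub
      (integrable_finsetSum Finset.univ fun i _ => hui ϑ i)
  have hfint : ∀ ϑ, ∫ x, f (ϑ, x) ∂η ϑ =
      Real.log (∫ x, Real.exp (-W ϑ x)) + meanFieldEnergy (W ϑ) (u (N ϑ)) := fun ϑ => by
    change ∫ x, (W ϑ x + Real.log (Zϑ ϑ) - ∑ i, u (N ϑ) i (x i))
      ∂(Measure.pi fun i => densityMeasure (u (N ϑ) i)) = _
    have hWi := (hW ϑ).integrable hκ (h (N ϑ))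
    rw [integral_sub (by exact hWi.add (integrable_const _))
        (integrable_finsetSum _ fun i _ => hui ϑ i), integral_add hWi (integrable_const _),
      integral_finsetSum _ fun i _ => hui ϑ i, meanFieldEnergy,
      Finset.sum_congr rfl fun i _ => integral_comp_eval
        (μ := fun i => densityMeasure (u (N ϑ) i)) (h (N ϑ) i).continuous.aestronglyMeasurable]
    simp only [integral_const, probReal_univ, one_smul]
    ring
  have hexp : ∀ ϑ, Integrable (fun x => Real.exp (-f (ϑ, x))) (η ϑ) ∧
      ∫ x, Real.exp (-f (ϑ, x)) ∂η ϑ = 1 := fun ϑ => by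
    have hUϑ : Measurable fun x => U (ϑ, x) := hUm.comp measurable_prodMk_left
    have e : (fun x => Real.exp (-U (ϑ, x)) • Real.exp (-f (ϑ, x))) =
        fun x => Real.exp (-W ϑ x) / Zϑ ϑ := by
      ext x
      rw [smul_eq_mul, ← Real.exp_add, div_eq_mul_inv]
      rw [show (Zϑ ϑ)⁻¹ = Real.exp (-Real.log (Zϑ ϑ)) by
        rw [Real.exp_neg, Real.exp_log (hZϑpos ϑ)]]
      rw [← Real.exp_add]
      congr 1
      simp only [hf]
      ring
    have hofReal : ∀ x, (ENNReal.ofReal (Real.exp (-U (ϑ, x)))).toReal = Real.exp (-U (ϑ, x)) :=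
      fun x => ENNReal.toReal_ofReal (Real.exp_pos _).le
    rw [hηd, integrable_withDensity_iff_integrable_smul' (by fun_prop) (by simp),
      integral_withDensity_eq_integral_toReal_smul (by fun_prop) (by simp)]
    simp only [hofReal, e]
    exact ⟨((hW ϑ).integrable_exp hκ).div_const _, by
      rw [integral_div, div_self (hZϑpos ϑ).ne']⟩
  have hInt : Integrable f (π₁ ⊗ₘ η) := by
    rw [Measure.integrable_compProd_iff hfm.aestronglyMeasurable]
    refine ⟨.of_forall hfi, Integrable.of_bound (C := B + 2) ?_ (.of_forall fun ϑ => ?_)⟩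
    · exact (hfm.stronglyMeasurable.norm.integral_kernel_prod_right').aestronglyMeasurable
    · rw [Real.norm_eq_abs, abs_of_nonneg (integral_nonneg fun x => norm_nonneg _)]
      calc _ ≤ ∫ x, (f (ϑ, x) + 2 * Real.exp (-f (ϑ, x))) ∂η ϑ := by
            refine integral_mono (hfi ϑ).norm ((hfi ϑ).add ((hexp ϑ).1.const_mul 2)) fun x => ?_
            have h1 := Real.add_one_le_exp (-f (ϑ, x))
            have h2 := Real.exp_pos (-f (ϑ, x))
            simp only [Real.norm_eq_abs]
            exact abs_le.2 ⟨by linarith, by linarith⟩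
        _ ≤ B + 2 := by
            rw [integral_add (hfi ϑ) ((hexp ϑ).1.const_mul 2), integral_const_mul, (hexp ϑ).2,
              hfint]
            linarith [hB ϑ]
  have hprob : IsProbabilityMeasure (starMeasure π₁ ν) := hμ ▸ inferInstance
  have := sigmaFinite_gibbs hVi
  refine ⟨starMeasure π₁ ν, ⟨hprob, π₁, ν, inferInstance, hν, rfl⟩, ?_⟩
  rw [KL_withDensity_exp hfm hμd (hμ ▸ hInt)]
  refine ENNReal.ofReal_le_ofReal ?_
  rw [hμ, Measure.integral_compProd hInt]
  have hInt' : Integrable (fun ϑ => ∫ x, f (ϑ, x) ∂η ϑ) π₁ :=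
    ((Measure.integrable_compProd_iff hfm.aestronglyMeasurable).1 hInt).2.mono'
      hfm.stronglyMeasurable.integral_kernel_prod_right'.aestronglyMeasurable
      (.of_forall fun ϑ => norm_integral_le_integral_norm _)
  calc _ ≤ ∫ ϑ, B ∂π₁ := integral_mono hInt' (integrable_const _) fun ϑ =>
        (hfint ϑ).trans_le (hB ϑ)
    _ = B := by simp

theorem sum_succAbove_eq_two_mul {d : ℕ} {f : Fin (d + 1) → Fin (d + 1) → ℝ}
    (hf : ∀ i j, f i j = f j i) :
    ∑ i, ∑ j, f i (i.succAbove j) = 2 * ∑ i, ∑ j, if i < j then f i j else 0 := by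
  have h1 : ∀ i, ∑ j, f i (i.succAbove j) = ∑ j, if i = j then 0 else f i j := fun i => by
    rw [Fin.sum_univ_succAbove _ i]
    simp [(Fin.succAbove_ne i _).symm]
  have h2 : ∀ i j, (if i = j then 0 else f i j) =
      (if i < j then f i j else 0) + if j < i then f j i else 0 := fun i j => by
    rcases lt_trichotomy i j with h | h | h
    · simp [h, h.ne, h.not_gt]
    · simp [h]
    · simp [h, h.ne', h.not_gt, hf i j]
  simp only [h1, h2, Finset.sum_add_distrib]
  rw [Finset.sum_comm (f := fun i j => if j < i then f j i else 0), two_mul]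

theorem convexOn_glmPotential {n d : ℕ} (X : Fin n → Fin d → ℝ) (w : Fin d → ℝ) (cσ : ℝ)
    (ψ : ℝ → ℝ) {ϱ : ℝ → ℝ} (hϱ : ConvexOn ℝ univ ϱ) (x : Fin d → ℝ) :
    ConvexOn ℝ univ fun ϑ => glmPotential X w cσ ψ ϱ ϑ x := by
  refine ⟨convex_univ, fun s _ t _ a b ha hb hab => ?_⟩
  simp only [smul_eq_mul, glmPotential]
  have h : ∑ j, ϱ (x j - (a * s + b * t)) ≤ a * ∑ j, ϱ (x j - s) + b * ∑ j, ϱ (x j - t) := by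
    rw [Finset.mul_sum, Finset.mul_sum, ← Finset.sum_add_distrib]
    refine Finset.sum_le_sum fun j _ => ?_
    have := hϱ.2 (mem_univ (x j - s)) (mem_univ (x j - t)) ha hb hab
    simp only [smul_eq_mul] at this
    refine le_of_eq_of_le (congrArg ϱ ?_) this
    linear_combination (-x j) * hab
  set k := -(∑ j, w j * x j) + (∑ l, ψ (∑ j, X l j * x j)) / cσ
  have : k = a * k + b * k := by rw [← add_mul, hab, one_mul]
  linarith

theorem exists_isStar_KL_glm_le {n d : ℕ} (X : Fin n → Fin (d + 1) → ℝ) (w : Fin (d + 1) → ℝ)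
    {cσ : ℝ} (hcσ : 0 < cσ) {g ψ ϱ : ℝ → ℝ} (hg : ContDiff ℝ 2 g) (hψ : ContDiff ℝ 2 ψ)
    (hϱ : ContDiff ℝ 2 ϱ) {a b B R α : ℝ} (ha : 0 < a) (hb : 0 < b) (hα : 0 < α)
    (hψ'' : ∀ t, b ≤ deriv (deriv ψ) t ∧ deriv (deriv ψ) t ≤ B)
    (hϱ'' : ∀ t, 0 ≤ deriv (deriv ϱ) t ∧ deriv (deriv ϱ) t ≤ R)
    (hg'' : ∀ t, α ≤ deriv (deriv g) t)
    (hA : ∀ v : Fin (d + 1) → ℝ,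
      a * ∑ j, v j ^ 2 ≤ ∑ i, ∑ j, v i * (cσ⁻¹ * ∑ l, X l i * X l j) * v j) {M ε : ℝ}
    (hM : ∀ β : Fin (d + 1) → ℝ,
      (∑ i : Fin (d + 1), ∑ j : Fin (d + 1), if i < j then
        (cσ⁻¹ * ∑ l, deriv (deriv ψ) (∑ r, X l r * β r) * X l i * X l j) ^ 2 else 0) ≤ M)
    (hε : 0 < ε) :
    ∃ μ, IsStar μ ∧
      KL μ (gibbs fun z : ℝ × (Fin (d + 1) → ℝ) => g z.1 + glmPotential X w cσ ψ ϱ z.1 z.2) ≤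
        ENNReal.ofReal (M / (a * b) ^ 2 + ε) := by
  have hκ : 0 < a * b := mul_pos ha hb
  obtain ⟨C, L, p, hW⟩ := exists_isNiceInteraction_glm w hcσ hψ hϱ hb hψ'' hϱ'' hA
  have hlin : deriv (fun t => ϱ 0 + deriv ϱ 0 * t) = fun _ => deriv ϱ 0 := by
    ext t
    simp
  obtain ⟨C₀, L₀, p₀, hW₀⟩ := exists_isNiceInteraction_glm w hcσ hψ
    (ϱ := fun t => ϱ 0 + deriv ϱ 0 * t) (by fun_prop) hb hψ'' (R := 0) (by simp [hlin]) hA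
  have hWc : Continuous fun z : ℝ × (Fin (d + 1) → ℝ) => glmPotential X w cσ ψ ϱ z.1 z.2 := by
    have := hψ.continuous
    have := hϱ.continuous
    unfold glmPotential
    fun_prop
  have hconv : ConvexOn ℝ univ ϱ :=
    convexOn_univ_of_deriv2_nonneg (fun x => (hϱ.hasDerivAt_deriv_two.1 x).differentiableAt)
      (fun x => (hϱ.hasDerivAt_deriv_two.2.1 x).differentiableAt) fun x => (hϱ'' x).1
  set c : ℝ := -((d + 1) * deriv ϱ 0) with hc
  have hlow : ∀ ϑ x, glmPotential X w cσ ψ (fun t => ϱ 0 + deriv ϱ 0 * t) 0 x + c * ϑ ≤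
      glmPotential X w cσ ψ ϱ ϑ x := fun ϑ x => by
    have h1 : ∑ j, (ϱ 0 + deriv ϱ 0 * (x j - 0)) + c * ϑ ≤ ∑ j, ϱ (x j - ϑ) := by
      have : c * ϑ = ∑ j : Fin (d + 1), -(deriv ϱ 0 * ϑ) := by
        simp [hc]
        ring
      rw [this, ← Finset.sum_add_distrib]
      refine Finset.sum_le_sum fun j _ => ?_
      have := hϱ.paraboloid_le (fun t => (hϱ'' t).1) 0 (x j - ϑ)
      simp only [sub_zero, zero_div, zero_mul, add_zero] at this ⊢
      linarith
    simp only [glmPotential]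
    linarith
  have hgi : Integrable fun ϑ => Real.exp (-(g ϑ + c * ϑ)) := by
    have hgc := hg.continuous
    have := integrable_mul_exp_neg_of_quadratic (W := fun ϑ => g ϑ + c * ϑ) (φ := fun _ => 1)
      (c₀ := g 0) (c₁ := deriv g 0 + c) (C := 1) hα (by fun_prop) (fun x => by
        have := hg.paraboloid_le hg'' 0 x
        simp only [sub_zero] at this
        linarith) aestronglyMeasurable_const (fun x => by
        rw [abs_one]
        nlinarith [sq_nonneg x])
    simpa using this
  have hMA : ∀ (ϑ : ℝ) (x : Fin (d + 1) → ℝ), ∑ i : Fin (d + 1), ∑ j : Fin d,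
      (cσ⁻¹ * ∑ l, deriv (deriv ψ) (∑ r, X l r * x r) * X l i * X l (i.succAbove j) +
        if i = i.succAbove j then deriv (deriv ϱ) (x i - ϑ) else 0) ^ 2 ≤ 2 * M := fun ϑ x => by
    simp only [(Fin.succAbove_ne _ _).symm, if_false, add_zero]
    rw [sum_succAbove_eq_two_mul (f := fun i j =>
      (cσ⁻¹ * ∑ l, deriv (deriv ψ) (∑ r, X l r * x r) * X l i * X l j) ^ 2)]
    · exact mul_le_mul_of_nonneg_left (hM x) zero_le_two
    · intro i j
      congr 2
      exact Finset.sum_congr rfl fun l _ => by ring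
  obtain ⟨N, u, v, hN, h, hB⟩ := IsNiceInteraction.exists_measurable_selection hκ hW hMA hWc
    ((hW₀ 0).integrable_exp hκ) hlow (convexOn_glmPotential X w cσ ψ hconv) hε
  exact IsNiceInteraction.exists_isStar_KL_le hκ hW hWc ((hW₀ 0).integrable_exp hκ) hlow
    hg.continuous hgi hN h hB

end

/-- **Approximation quality of SSVI for Bayesian GLMs with location-family priors.**
The state is `(ϑ, β) ∈ ℝ × ℝ^d` with root `ϑ`; the posterior is
`π_loc ∝ exp (-V_loc)` with
`V_loc(ϑ, β) = g(ϑ) - wᵀβ + ∑ᵢ ψ(Xᵢᵀβ)/c(σ) + ∑ⱼ ϱ(βⱼ - ϑ)`.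
The `L∞` bound on `∑_{i<j} 𝒜_{ij}²` is expressed via an arbitrary pointwise
bound `M` (equivalently, the essential supremum). -/
theorem stmt9 {n d : ℕ} (hd : 1 ≤ d)
    (X : Fin n → Fin d → ℝ) (w : Fin d → ℝ) (cσ : ℝ) (hcσ : 0 < cσ)
    (g ψ ϱ : ℝ → ℝ) (hg : ContDiff ℝ 2 g) (hψ : ContDiff ℝ 2 ψ) (hϱ : ContDiff ℝ 2 ϱ)
    (b B R a α L : ℝ) (hb : 0 < b) (hbB : b ≤ B)
    (hψ'' : ∀ t, b ≤ deriv (deriv ψ) t ∧ deriv (deriv ψ) t ≤ B)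
    (hϱ'' : ∀ t, 0 ≤ deriv (deriv ϱ) t ∧ deriv (deriv ϱ) t ≤ R)
    (ha : 0 < a)
    -- A = (1/c(σ)) XᵀX ⪰ a I
    (hA : ∀ v : Fin d → ℝ,
      a * ∑ j, v j ^ 2 ≤ ∑ i, ∑ j, v i * (cσ⁻¹ * ∑ l, X l i * X l j) * v j)
    (hg'' : ∀ t, α ≤ deriv (deriv g) t ∧ deriv (deriv g) t ≤ L)
    -- ℓ'_V = α - d R² / (a b) > 0
    (hℓ' : 0 < α - d * R ^ 2 / (a * b))
    (π : Measure (ℝ × (Fin d → ℝ))) [IsProbabilityMeasure π]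
    (hπ : π = gibbs fun z : ℝ × (Fin d → ℝ) =>
      g z.1 - (∑ j, w j * z.2 j) + (∑ i, ψ (∑ j, X i j * z.2 j)) / cσ
        + ∑ j, ϱ (z.2 j - z.1))
    -- π⋆ : the star-structured variational minimizer
    (πstar : Measure (ℝ × (Fin d → ℝ))) (hstar : IsStar πstar)
    (hmin : ∀ μ, IsStar μ → KL πstar π ≤ KL μ π) :
    ∀ M : ℝ,
      (∀ β : Fin d → ℝ,
        (∑ i : Fin d, ∑ j : Fin d, if i < j then
          (cσ⁻¹ * ∑ l, deriv (deriv ψ) (∑ r, X l r * β r) * X l i * X l j) ^ 2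
        else 0) ≤ M) →
      KL πstar π ≤ ENNReal.ofReal
        ((d * R + L) / (a ^ 2 * b ^ 2 * (α - d * R ^ 2 / (a * b))) * M) := by
  intro M hM
  obtain ⟨d, rfl⟩ := Nat.exists_eq_add_of_le' hd
  have hM0 : 0 ≤ M := (Finset.sum_nonneg fun i _ => Finset.sum_nonneg fun j _ => by
    split_ifs <;> positivity).trans (hM 0)
  have hR : 0 ≤ R := (hϱ'' 0).1.trans (hϱ'' 0).2
  have hκ : 0 < a * b := mul_pos ha hb
  have hq : 0 ≤ ((d + 1 : ℕ) : ℝ) * R ^ 2 / (a * b) := by positivity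
  have hα : 0 < α := by linarith
  have hαL : α ≤ L := (hg'' 0).1.trans (hg'' 0).2
  have hπ' : π = gibbs fun z : ℝ × (Fin (d + 1) → ℝ) =>
      g z.1 + glmPotential X w cσ ψ ϱ z.1 z.2 := by
    rw [hπ]
    congr 1
    ext z
    rw [glmPotential]
    ring
  have hle : KL πstar π ≤ ENNReal.ofReal (M / (a * b) ^ 2) := by
    have ht : Filter.Tendsto (fun ε : ℝ => ENNReal.ofReal (M / (a * b) ^ 2 + ε))
        (nhdsWithin 0 (Set.Ioi 0)) (nhds (ENNReal.ofReal (M / (a * b) ^ 2))) := by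
      have : Continuous fun ε : ℝ => ENNReal.ofReal (M / (a * b) ^ 2 + ε) :=
        ENNReal.continuous_ofReal.comp (by fun_prop)
      simpa using (this.tendsto 0).mono_left nhdsWithin_le_nhds
    refine ge_of_tendsto ht (Filter.eventually_of_mem self_mem_nhdsWithin fun ε hε => ?_)
    obtain ⟨μ, hμ, hKL⟩ := exists_isStar_KL_glm_le X w hcσ hg hψ hϱ ha hb hα hψ'' hϱ''
      (fun t => (hg'' t).1) hA hM hε
    exact (hmin μ hμ).trans (hπ' ▸ hKL)
  refine hle.trans (ENNReal.ofReal_le_ofReal ?_)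
  rw [div_eq_inv_mul, ← mul_pow]
  refine mul_le_mul_of_nonneg_right ?_ hM0
  rw [inv_eq_one_div, div_le_div_iff₀ (by positivity) (by positivity)]
  have hdR : 0 ≤ ((d + 1 : ℕ) : ℝ) * R := by positivity
  have := mul_le_mul_of_nonneg_left (show α - ((d + 1 : ℕ) : ℝ) * R ^ 2 / (a * b) ≤
    ((d + 1 : ℕ) : ℝ) * R + L by linarith) (show 0 ≤ (a * b) ^ 2 by positivity)
  linarith
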